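/- For n ≥ 4, the set of fully commutative elements of the Coxeter group W(Dₙ) is finite and has cardinality ((n+3)·catalan n − 2)/2, i.e., ((n+3)/2)·C(n) − 1 where C(n) is the n-th Catalan number. -/

import Mathlib

noncomputable section

/-- Adjacency in the Coxeter graph of type `Dₙ`: the index set is `Fin n`, where `0`
stands for the generator `s₁̄` and `k` stands for `sₖ` for `1 ≤ k ≤ n − 1`.  The vertex
`s₁̄` is joined to `s₂`, and the vertices `s₁, …, s_{n−1}` form a path. -/
def DnAdj (n : ℕ) (i j : Fin n) : Prop :=
  ((i : ℕ) = 0 ∧ (j : ℕ) = 2) ∨ ((j : ℕ) = 0 ∧ (i : ℕ) = 2) ∨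
    (1 ≤ (i : ℕ) ∧ 1 ≤ (j : ℕ) ∧ ((i : ℕ) + 1 = (j : ℕ) ∨ (j : ℕ) + 1 = (i : ℕ)))

instance (n : ℕ) (i j : Fin n) : Decidable (DnAdj n i j) := by
  unfold DnAdj; infer_instance

theorem DnAdj.symm {n : ℕ} {i j : Fin n} (h : DnAdj n i j) : DnAdj n j i := by
  unfold DnAdj at *; tauto

/-- The Coxeter matrix of type `Dₙ`, with index set `Fin n`, where `0` stands for the
generator `s₁̄` and `k` stands for `sₖ` for `1 ≤ k ≤ n − 1`. -/
def DnMatrix (n : ℕ) : CoxeterMatrix (Fin n) where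
  M := Matrix.of fun i j => if i = j then 1 else if DnAdj n i j then 3 else 2
  isSymm := by
    ext i j
    simp only [Matrix.transpose_apply, Matrix.of_apply]
    by_cases h : i = j
    · subst h; simp
    · rw [if_neg h, if_neg (Ne.symm h)]
      by_cases h2 : DnAdj n i j
      · rw [if_pos h2, if_pos h2.symm]
      · rw [if_neg h2, if_neg (fun hc => h2 hc.symm)]
  diagonal := fun i => by simp
  off_diagonal := fun i j h => by
    simp only [Matrix.of_apply]
    rw [if_neg h]
    split <;> norm_num

/-- A *commutation move* on words: replace a contiguous subword `[i, j]` by `[j, i]`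
whenever `M i j = 2`. -/
def CommutationMoveRel {B : Type*} (M : CoxeterMatrix B) (ω ω' : List B) : Prop :=
  ∃ (i j : B) (l₁ l₂ : List B), M i j = 2 ∧
    ω = l₁ ++ [i, j] ++ l₂ ∧ ω' = l₁ ++ [j, i] ++ l₂

/-- `w` is *fully commutative* if any two reduced words for `w` are related by a sequence
of commutation moves. -/
def IsFullyCommutative {B : Type*} {W : Type*} [Group W] {M : CoxeterMatrix B}
    (cs : CoxeterSystem M W) (w : W) : Prop :=
  ∀ ω ω' : List B, cs.IsReduced ω → cs.IsReduced ω' →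
    cs.wordProd ω = w → cs.wordProd ω' = w →
    Relation.ReflTransGen (CommutationMoveRel M) ω ω'

/-! ### Words up to commutations -/

section Words

variable {α β : Type*} (adj : α → α → Prop)

/-- Two words are related when one is obtained from the other by exchanging two consecutive
letters that are distinct and not adjacent. -/
def CommStep (l l' : List α) : Prop :=
  ∃ (i j : α) (l₁ l₂ : List α), (i ≠ j ∧ ¬ adj i j ∧ ¬ adj j i) ∧
    l = l₁ ++ [i, j] ++ l₂ ∧ l' = l₁ ++ [j, i] ++ l₂

/-- Commutation equivalence of words. -/
def CommEquiv : List α → List α → Prop := Relation.ReflTransGen (CommStep adj)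

variable {adj}

theorem CommStep.symm {l l' : List α} (h : CommStep adj l l') : CommStep adj l' l := by
  obtain ⟨i, j, l₁, l₂, ⟨h1, h2, h3⟩, rfl, rfl⟩ := h
  exact ⟨j, i, l₁, l₂, ⟨h1.symm, h3, h2⟩, rfl, rfl⟩

theorem CommEquiv.refl (l : List α) : CommEquiv adj l l := Relation.ReflTransGen.refl

theorem CommEquiv.symm {l l' : List α} (h : CommEquiv adj l l') : CommEquiv adj l' l := by
  induction h with
  | refl => exact .refl _
  | tail _ h ih => exact .head h.symm ih

theorem CommEquiv.trans {l l' l'' : List α} (h : CommEquiv adj l l') (h' : CommEquiv adj l' l'') :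
    CommEquiv adj l l'' := Relation.ReflTransGen.trans h h'

theorem CommEquiv.append_left (u : List α) {l l' : List α} (h : CommEquiv adj l l') :
    CommEquiv adj (u ++ l) (u ++ l') := by
  refine Relation.ReflTransGen.lift (u ++ ·) ?_ _ _ h
  rintro _ _ ⟨i, j, l₁, l₂, h, rfl, rfl⟩
  exact ⟨i, j, u ++ l₁, l₂, h, by simp, by simp⟩

theorem CommEquiv.append_right (u : List α) {l l' : List α} (h : CommEquiv adj l l') :
    CommEquiv adj (l ++ u) (l' ++ u) := by
  refine Relation.ReflTransGen.lift (· ++ u) ?_ _ _ h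
  rintro _ _ ⟨i, j, l₁, l₂, h, rfl, rfl⟩
  exact ⟨i, j, l₁, l₂ ++ u, h, by simp, by simp⟩

theorem CommEquiv.cons (a : α) {l l' : List α} (h : CommEquiv adj l l') :
    CommEquiv adj (a :: l) (a :: l') := h.append_left [a]

theorem CommEquiv.swap {i j : α} (h : i ≠ j ∧ ¬ adj i j ∧ ¬ adj j i) (l : List α) :
    CommEquiv adj (i :: j :: l) (j :: i :: l) :=
  Relation.ReflTransGen.single ⟨i, j, [], l, h, rfl, rfl⟩

theorem CommEquiv.cons_append_singleton {t : α} {l : List α}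
    (h : ∀ x ∈ l, t ≠ x ∧ ¬ adj t x ∧ ¬ adj x t) : CommEquiv adj (t :: l) (l ++ [t]) := by
  induction l with
  | nil => exact .refl _
  | cons a l ih =>
    exact (CommEquiv.swap (h a (by simp)) l).trans ((ih fun x hx => h x (by simp [hx])).cons a)

theorem CommEquiv.perm {l l' : List α} (h : CommEquiv adj l l') : l.Perm l' := by
  induction h with
  | refl => rfl
  | tail _ h ih =>
    obtain ⟨i, j, l₁, l₂, -, rfl, rfl⟩ := h
    refine ih.trans ?_
    simpa using (List.Perm.swap j i l₂).append_left l₁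

variable [DecidableEq α] (adj) [DecidableRel adj]

/-- At least `c` letters adjacent to `s` precede the first occurrence (if any) of `s`. -/
def Spaced (s : α) : ℕ → List α → Prop
  | _, [] => True
  | c, a :: l => if a = s then c = 0 else Spaced s (if adj s a then c - 1 else c) l

/-- Between two consecutive occurrences of a letter `s`
there are at least two letters adjacent to `s`. -/
def Good : List α → Prop
  | [] => True
  | s :: l => Good l ∧ Spaced adj s 2 l

variable {adj}

@[simp] theorem spaced_nil (s : α) (c : ℕ) : Spaced adj s c [] := trivial

theorem spaced_cons (s : α) (c : ℕ) (a : α) (l : List α) :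
    Spaced adj s c (a :: l) ↔
      if a = s then c = 0 else Spaced adj s (if adj s a then c - 1 else c) l := Iff.rfl

theorem spaced_cons_of_adj {s a : α} (c : ℕ) (l : List α) (h : a ≠ s) (h' : adj s a) :
    Spaced adj s c (a :: l) ↔ Spaced adj s (c - 1) l := by
  simp [spaced_cons, h, h']

theorem spaced_cons_of_not_adj {s a : α} (c : ℕ) (l : List α) (h : a ≠ s) (h' : ¬ adj s a) :
    Spaced adj s c (a :: l) ↔ Spaced adj s c l := by
  simp [spaced_cons, h, h']

theorem spaced_cons_self (s : α) (c : ℕ) (l : List α) : Spaced adj s c (s :: l) ↔ c = 0 := by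
  simp [spaced_cons]

@[simp] theorem good_nil : Good adj [] := trivial

theorem good_cons (s : α) (l : List α) :
    Good adj (s :: l) ↔ Good adj l ∧ Spaced adj s 2 l := Iff.rfl

theorem spaced_zero (s : α) (l : List α) : Spaced adj s 0 l := by
  induction l with
  | nil => trivial
  | cons a l ih => simp [spaced_cons, ih]

theorem spaced_of_notMem {s : α} {l : List α} (h : s ∉ l) (c : ℕ) : Spaced adj s c l := by
  induction l generalizing c with
  | nil => trivial
  | cons a l ih =>
    rw [List.mem_cons, not_or] at h
    rw [spaced_cons, if_neg (Ne.symm h.1)]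
    exact ih h.2 _

theorem spaced_append_of_forall_not_adj {s : α} {u : List α} (c : ℕ) (l : List α)
    (h : ∀ x ∈ u, x ≠ s ∧ ¬ adj s x) : Spaced adj s c (u ++ l) ↔ Spaced adj s c l := by
  induction u with
  | nil => rfl
  | cons a u ih =>
    have ha := h a (by simp)
    rw [List.cons_append, spaced_cons_of_not_adj _ _ ha.1 ha.2]
    exact ih fun x hx => h x (by simp [hx])

theorem spaced_iff (s : α) (c : ℕ) (l : List α) :
    Spaced adj s c l ↔
      ∀ y z, l = y ++ s :: z → s ∉ y → c ≤ y.countP (fun x => adj s x) := by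
  induction l generalizing c with
  | nil => simp
  | cons a l ih =>
    by_cases h : a = s
    · subst h
      rw [spaced_cons_self]
      constructor
      · rintro rfl; simp
      · intro h; simpa using h [] l rfl
    · rw [spaced_cons, if_neg h, ih]
      constructor
      · intro H y z hy hs
        cases y with
        | nil => simp at hy; exact absurd hy.1 h
        | cons b y =>
          simp only [List.cons_append, List.cons.injEq] at hy
          obtain ⟨rfl, hy⟩ := hy
          have := H y z hy (by simp_all)
          rw [List.countP_cons]
          by_cases h' : adj s a <;> simp [h'] at this ⊢ <;> omega
      · intro H y z hy hs
        have := H (a :: y) z (by simp [hy]) (by simp [hs, Ne.symm h])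
        rw [List.countP_cons] at this
        by_cases h' : adj s a <;> simp [h'] at this ⊢ <;> omega

theorem Good.of_append {u l : List α} (h : Good adj (u ++ l)) : Good adj l := by
  induction u with
  | nil => exact h
  | cons a u ih => exact ih h.1

theorem spaced_swap {i j : α} (h : i ≠ j ∧ ¬ adj i j ∧ ¬ adj j i) (s : α) (c : ℕ)
    (l₁ l₂ : List α) :
    Spaced adj s c (l₁ ++ [i, j] ++ l₂) ↔ Spaced adj s c (l₁ ++ [j, i] ++ l₂) := by
  induction l₁ generalizing c with
  | nil =>
    obtain ⟨h1, h2, h3⟩ := h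
    by_cases hi : i = s
    · subst hi; simp [spaced_cons, h1.symm, h2]
    · by_cases hj : j = s
      · subst hj; simp [spaced_cons, h1, h3]
      · simp only [List.nil_append, List.cons_append, spaced_cons, hi, hj, if_false]
        split_ifs <;> rfl
  | cons a l ih =>
    simp only [List.cons_append, spaced_cons] at ih ⊢
    split_ifs
    · rfl
    · exact ih _
    · exact ih _

theorem good_swap {i j : α} (h : i ≠ j ∧ ¬ adj i j ∧ ¬ adj j i) (l₁ l₂ : List α) :
    Good adj (l₁ ++ [i, j] ++ l₂) ↔ Good adj (l₁ ++ [j, i] ++ l₂) := by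
  induction l₁ with
  | nil =>
    obtain ⟨h1, h2, h3⟩ := h
    simp only [List.nil_append, List.cons_append, good_cons,
      spaced_cons_of_not_adj _ _ h1.symm h2, spaced_cons_of_not_adj _ _ h1 h3]
    tauto
  | cons a l ih =>
    simp only [List.cons_append, good_cons] at ih ⊢
    rw [ih]
    exact and_congr_right fun _ => spaced_swap h a 2 l l₂

theorem CommEquiv.good_iff {l l' : List α} (h : CommEquiv adj l l') :
    Good adj l ↔ Good adj l' := by
  induction h with
  | refl => rfl
  | tail _ h ih =>
    obtain ⟨i, j, l₁, l₂, h, rfl, rfl⟩ := h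
    rw [ih, good_swap h]

theorem good_map_iff [DecidableEq β] {adj' : β → β → Prop} [DecidableRel adj'] {f : α → β}
    (hf : Function.Injective f) (hadj : ∀ i j, adj' (f i) (f j) ↔ adj i j) (l : List α) :
    Good adj' (l.map f) ↔ Good adj l := by
  have key (s : α) (c : ℕ) (l : List α) : Spaced adj' (f s) c (l.map f) ↔ Spaced adj s c l := by
    induction l generalizing c with
    | nil => simp
    | cons a l ih => simp only [List.map_cons, spaced_cons, hf.eq_iff, hadj, ih]
  induction l with
  | nil => simp
  | cons a l ih => rw [List.map_cons, good_cons, good_cons, key]; exact and_congr_left' ih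

end Words

/-! ### The exchange property -/

namespace CoxeterSystem

open scoped Classical in
/-- The permutation of `W × ZMod 2` attached to a simple reflection, which conjugates the first
component and records in the second one whether the latter is the simple reflection itself. -/
def parityPerm {B W : Type*} [Group W] {M : CoxeterMatrix B} (cs : CoxeterSystem M W) (i : B) :
    Equiv.Perm (W × ZMod 2) :=
  Function.Involutive.toPerm
    (fun p => (cs.simple i * p.1 * cs.simple i, p.2 + if p.1 = cs.simple i then 1 else 0)) (by
      rintro ⟨t, ε⟩
      have h : cs.simple i * t * cs.simple i = cs.simple i ↔ t = cs.simple i := by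
        rw [mul_assoc, mul_eq_left, mul_eq_one_iff_eq_inv, cs.inv_simple]
      ext
      · simp [mul_assoc]
      · simp only [h]
        split_ifs <;> simp [add_assoc, CharTwo.add_self_eq_zero])

variable {B W : Type*} [Group W] {M : CoxeterMatrix B} (cs : CoxeterSystem M W)

open scoped Classical in
theorem parityPerm_apply (i : B) (t : W) (ε : ZMod 2) :
    cs.parityPerm i (t, ε) =
      (cs.simple i * t * cs.simple i, ε + if t = cs.simple i then 1 else 0) := rfl

open scoped Classical in
theorem parityPerm_mul_pow_apply (i j : B) (m : ℕ) (t : W) (ε : ZMod 2) :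
    ((cs.parityPerm i * cs.parityPerm j) ^ m) (t, ε) =
      ((cs.simple i * cs.simple j) ^ m * t * ((cs.simple i * cs.simple j) ^ m)⁻¹,
        ε + ∑ l ∈ Finset.range (2 * m),
          if t = cs.simple j * (cs.simple i * cs.simple j) ^ l then 1 else 0) := by
  induction m with
  | zero => simp
  | succ m ih =>
    set x := cs.simple i * cs.simple j with hx
    have hinv : x⁻¹ = cs.simple j * cs.simple i := by simp [hx]
    have hconj : cs.simple j * x * cs.simple j = x⁻¹ := by
      rw [hinv, hx]; simp [mul_assoc]
    have hpow (k : ℕ) : x ^ k * cs.simple j = cs.simple j * (x ^ k)⁻¹ := by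
      rw [← inv_pow, ← hconj]
      have : cs.simple j * x * cs.simple j = cs.simple j * x * (cs.simple j)⁻¹ := by simp
      rw [this, conj_pow]
      simp [mul_assoc]
    rw [pow_succ', Equiv.Perm.mul_apply, ih, Equiv.Perm.mul_apply, parityPerm_apply,
      parityPerm_apply]
    have h1 : x ^ m * t * (x ^ m)⁻¹ = cs.simple j ↔ t = cs.simple j * x ^ (2 * m) := by
      rw [mul_inv_eq_iff_eq_mul, ← eq_inv_mul_iff_mul_eq]
      have : (x ^ m)⁻¹ * (cs.simple j * x ^ m) = cs.simple j * x ^ (2 * m) := by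
        rw [inv_mul_eq_iff_eq_mul, ← mul_assoc, hpow, two_mul, pow_add]; group
      rw [this]
    have h2 : cs.simple j * (x ^ m * t * (x ^ m)⁻¹) * cs.simple j = cs.simple i ↔
        t = cs.simple j * x ^ (2 * m + 1) := by
      have e1 : cs.simple j * (x ^ m * t * (x ^ m)⁻¹) * cs.simple j = cs.simple i ↔
          x ^ m * t * (x ^ m)⁻¹ = cs.simple j * cs.simple i * cs.simple j := by
        constructor
        · intro h; rw [← h]; simp [mul_assoc]
        · intro h; rw [h]; simp [mul_assoc]
      rw [e1, mul_inv_eq_iff_eq_mul, ← eq_inv_mul_iff_mul_eq]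
      have : (x ^ m)⁻¹ * (cs.simple j * cs.simple i * cs.simple j * x ^ m) =
          cs.simple j * x ^ (2 * m + 1) := by
        rw [inv_mul_eq_iff_eq_mul, ← mul_assoc, hpow, mul_assoc, mul_assoc,
          mul_assoc (cs.simple j) (x ^ m)⁻¹, mul_right_inj, ← mul_assoc, ← hx, ← pow_succ',
          eq_inv_mul_iff_mul_eq, ← pow_add]
        congr 1; ring
      rw [this]
    ext
    · simp only [pow_succ', hx, mul_inv_rev, inv_simple]
      simp only [mul_assoc]
    · simp only [h1, h2]
      rw [show 2 * (m + 1) = 2 * m + 1 + 1 by ring, Finset.sum_range_succ, Finset.sum_range_succ]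
      ring

theorem isLiftable_parityPerm : M.IsLiftable cs.parityPerm := by
  classical
  intro i j
  ext1 ⟨t, ε⟩
  rw [parityPerm_mul_pow_apply, cs.simple_mul_simple_pow, two_mul, Finset.sum_range_add]
  simp [pow_add, CharTwo.add_self_eq_zero]

/-- The action of a Coxeter group on `W × ZMod 2` recording parities of inversions. -/
def parityHom : W →* Equiv.Perm (W × ZMod 2) :=
  cs.lift ⟨cs.parityPerm, cs.isLiftable_parityPerm⟩

theorem parityHom_wordProd [DecidableEq W] (ω : List B) (t : W) (ε : ZMod 2) :
    cs.parityHom (cs.wordProd ω) (t, ε) =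
      (cs.wordProd ω * t * (cs.wordProd ω)⁻¹, ε + (cs.rightInvSeq ω).count t) := by
  induction ω with
  | nil => simp
  | cons i ω ih =>
    have h : cs.wordProd ω * t * (cs.wordProd ω)⁻¹ = cs.simple i ↔
        (cs.wordProd ω)⁻¹ * cs.simple i * cs.wordProd ω = t := by
      rw [mul_inv_eq_iff_eq_mul, mul_assoc, inv_mul_eq_iff_eq_mul, eq_comm]
    rw [wordProd_cons, map_mul, Equiv.Perm.mul_apply, ih, parityHom, lift_apply_simple,
      parityPerm_apply, rightInvSeq, List.count_cons]
    ext
    · simp [mul_assoc]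
    · simp only [h, beq_iff_eq]
      push_cast
      ring

theorem mem_rightInvSeq_of_isRightDescent {ω : List B} {i : B}
    (h : cs.IsRightDescent (cs.wordProd ω) i) : cs.simple i ∈ cs.rightInvSeq ω := by
  classical
  obtain ⟨ω', hω', e⟩ := cs.exists_isReduced (cs.wordProd ω * cs.simple i)
  have hprod : cs.wordProd (ω'.concat i) = cs.wordProd ω := by
    rw [wordProd_concat, ← e]; simp
  have hred : cs.IsReduced (ω'.concat i) := by
    rw [IsReduced, hprod, List.length_concat, ← hω'.eq, ← e]
    exact (cs.isRightDescent_iff.1 h).symm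
  have hcount : (cs.rightInvSeq (ω'.concat i)).count (cs.simple i) = 1 :=
    List.count_eq_one_of_mem hred.nodup_rightInvSeq (by rw [rightInvSeq_concat]; simp)
  have := congrArg (fun f => (f (cs.simple i, 0)).2) (congrArg cs.parityHom hprod)
  simp only [parityHom_wordProd, hcount] at this
  by_contra hn
  rw [List.count_eq_zero_of_not_mem hn] at this
  simp at this

theorem exists_eraseIdx_of_isLeftDescent {ω : List B} {i : B}
    (h : cs.IsLeftDescent (cs.wordProd ω) i) :
    ∃ j < ω.length, cs.simple i * cs.wordProd ω = cs.wordProd (ω.eraseIdx j) := by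
  have h' : cs.simple i ∈ cs.leftInvSeq ω := by
    rw [← cs.isRightDescent_inv_iff, ← wordProd_reverse] at h
    simpa [rightInvSeq_reverse] using cs.mem_rightInvSeq_of_isRightDescent h
  obtain ⟨j, hj, e⟩ := List.mem_iff_getElem.1 h'
  refine ⟨j, by simpa using hj, ?_⟩
  rw [← getD_leftInvSeq_mul_wordProd, ← e, List.getD_eq_getElem]

end CoxeterSystem

/-! ### Fully commutative elements of simply laced Coxeter groups -/

namespace CoxeterSystem

variable {B W : Type*} [Group W] {M : CoxeterMatrix B} (cs : CoxeterSystem M W)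

theorem simple_mul_comm_of_eq_two {i j : B} (h : M i j = 2) :
    cs.simple i * cs.simple j = cs.simple j * cs.simple i := by
  have := cs.simple_mul_simple_pow i j
  rw [h, pow_two, mul_eq_one_iff_eq_inv, mul_inv_rev, inv_simple, inv_simple] at this
  exact this

theorem simple_mul_simple_mul_simple_of_eq_three {i j : B} (h : M i j = 3) :
    cs.simple i * cs.simple j * cs.simple i = cs.simple j * cs.simple i * cs.simple j := by
  have := cs.simple_mul_simple_pow i j
  rw [h, pow_succ, pow_two, mul_assoc, mul_assoc, mul_assoc, ← mul_assoc, ← mul_assoc,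
    mul_eq_one_iff_eq_inv] at this
  simpa [mul_assoc] using this

theorem isReduced_of_cons {i : B} {ω : List B} (h : cs.IsReduced (i :: ω)) : cs.IsReduced ω := by
  simpa using h.drop 1

theorem isReduced_of_length_le {ω : List B} {w : W} (h : cs.wordProd ω = w)
    (h' : ω.length ≤ cs.length w) : cs.IsReduced ω :=
  le_antisymm (cs.length_wordProd_le ω) (by rwa [h])

theorem isLeftDescent_of_isReduced_cons {i : B} {ω : List B} (h : cs.IsReduced (i :: ω)) :
    cs.IsLeftDescent (cs.wordProd (i :: ω)) i := by
  have h' := cs.isReduced_of_cons h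
  rw [IsLeftDescent, h.eq, wordProd_cons, simple_mul_simple_cancel_left, h'.eq]
  simp

theorem exists_isReduced_cons_cons {w : W} {i j : B} (hij : cs.simple i ≠ cs.simple j)
    (hi : cs.IsLeftDescent w i) (hj : cs.IsLeftDescent w j) :
    ∃ c, cs.IsReduced (i :: j :: c) ∧ cs.wordProd (i :: j :: c) = w := by
  obtain ⟨b, hb, e⟩ := cs.exists_isReduced (cs.simple j * w)
  have hw : cs.wordProd (j :: b) = w := by rw [wordProd_cons, ← e]; simp
  have hlen : b.length + 1 = cs.length w := by
    rw [← hb.eq, ← e]; exact cs.isLeftDescent_iff.1 hj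
  obtain ⟨k, hk, ek⟩ := cs.exists_eraseIdx_of_isLeftDescent (ω := j :: b) (i := i) (by rwa [hw])
  cases k with
  | zero =>
    rw [List.eraseIdx_zero, List.tail_cons, wordProd_cons, ← mul_assoc, mul_eq_right,
      mul_eq_one_iff_eq_inv, inv_simple] at ek
    exact absurd ek hij
  | succ k =>
    rw [List.eraseIdx_cons_succ, hw] at ek
    have hp : cs.wordProd (i :: j :: b.eraseIdx k) = w := by
      rw [wordProd_cons, ← ek]; simp
    refine ⟨b.eraseIdx k, cs.isReduced_of_length_le hp ?_, hp⟩
    rw [← hlen, List.length_cons, List.length_cons, List.length_eraseIdx_add_one]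
    simpa using hk

theorem exists_isReduced_cons_cons_cons {w : W} {i j : B} (hij : cs.simple i ≠ cs.simple j)
    (hM : M i j = 3) (hi : cs.IsLeftDescent w i) (hj : cs.IsLeftDescent w j) :
    ∃ c, cs.IsReduced (i :: j :: i :: c) ∧ cs.wordProd (i :: j :: i :: c) = w := by
  obtain ⟨b, hb, e⟩ := cs.exists_isReduced_cons_cons hij.symm hj hi
  have hlen : b.length + 2 = cs.length w := by
    rw [← e, hb.eq]; rfl
  obtain ⟨k, hk, ek⟩ := cs.exists_eraseIdx_of_isLeftDescent (ω := j :: i :: b) (i := i)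
    (by rwa [e])
  have hb' := cs.isReduced_of_cons hb
  match k with
  | 0 =>
    rw [List.eraseIdx_zero, List.tail_cons, wordProd_cons, ← mul_assoc, mul_eq_right,
      mul_eq_one_iff_eq_inv, inv_simple] at ek
    exact absurd ek hij
  | 1 =>
    simp only [List.eraseIdx_cons_succ, List.eraseIdx_zero, List.tail_cons, wordProd_cons,
      ← mul_assoc, mul_left_inj] at ek
    rw [cs.simple_mul_simple_mul_simple_of_eq_three hM, mul_assoc, mul_eq_left,
      mul_eq_one_iff_eq_inv, inv_simple] at ek
    exact absurd ek hij
  | k + 2 =>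
    rw [List.eraseIdx_cons_succ, List.eraseIdx_cons_succ, e] at ek
    have hp : cs.wordProd (i :: j :: i :: b.eraseIdx k) = w := by
      rw [wordProd_cons, ← ek]; simp
    refine ⟨b.eraseIdx k, cs.isReduced_of_length_le hp ?_, hp⟩
    rw [← hlen]
    simp only [List.length_cons]
    rw [List.length_eraseIdx_add_one]
    simpa using hk

end CoxeterSystem

section SimplyLaced

variable {B W : Type*} [DecidableEq B] [Group W] {M : CoxeterMatrix B} (cs : CoxeterSystem M W)

theorem not_good_cons_self {adj : B → B → Prop} [DecidableRel adj] (i : B) (l : List B) :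
    ¬ Good adj (i :: i :: l) := fun h => by simpa [spaced_cons] using h.2

theorem not_good_cons_cons_self {adj : B → B → Prop} [DecidableRel adj] {i j : B} (hij : i ≠ j)
    (l : List B) : ¬ Good adj (i :: j :: i :: l) := fun h => by
  have := h.2
  rw [spaced_cons, if_neg hij.symm, spaced_cons_self] at this
  split_ifs at this

/-- Adjacency in the Coxeter graph of a simply laced Coxeter matrix. -/
abbrev CoxeterMatrix.Adj {B : Type*} (M : CoxeterMatrix B) (i j : B) : Prop := M i j = 3

instance : DecidableRel M.Adj := fun _ _ => inferInstanceAs (Decidable (_ = _))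

variable {cs}

theorem eq_two_iff_of_simplyLaced (hM : ∀ i j, i ≠ j → M i j = 2 ∨ M i j = 3) {i j : B} :
    (i ≠ j ∧ ¬ M.Adj i j ∧ ¬ M.Adj j i) ↔ M i j = 2 := by
  rw [CoxeterMatrix.Adj, CoxeterMatrix.Adj, M.symmetric j i, and_self]
  by_cases h : i = j
  · subst h; simp
  · rcases hM i j h with h' | h' <;> simp [h, h']

theorem commStep_iff_of_simplyLaced (hM : ∀ i j, i ≠ j → M i j = 2 ∨ M i j = 3)
    (ω ω' : List B) :
    CommStep M.Adj ω ω' ↔ CommutationMoveRel M ω ω' := by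
  simp only [CommStep, CommutationMoveRel, eq_two_iff_of_simplyLaced hM]

theorem commEquiv_iff_of_simplyLaced (hM : ∀ i j, i ≠ j → M i j = 2 ∨ M i j = 3)
    (ω ω' : List B) :
    CommEquiv M.Adj ω ω' ↔ Relation.ReflTransGen (CommutationMoveRel M) ω ω' := by
  have : CommStep M.Adj = CommutationMoveRel M :=
    funext₂ fun _ _ => propext (commStep_iff_of_simplyLaced hM _ _)
  rw [CommEquiv, this]

theorem CommEquiv.wordProd_eq (hM : ∀ i j, i ≠ j → M i j = 2 ∨ M i j = 3) {ω ω' : List B}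
    (h : CommEquiv M.Adj ω ω') :
    cs.wordProd ω = cs.wordProd ω' := by
  induction h with
  | refl => rfl
  | tail _ h ih =>
    obtain ⟨i, j, l₁, l₂, h2, rfl, rfl⟩ := (commStep_iff_of_simplyLaced hM _ _).1 h
    rw [ih]
    have hc := cs.simple_mul_comm_of_eq_two h2
    simp only [CoxeterSystem.wordProd_append, CoxeterSystem.wordProd_cons, ← mul_assoc]
    simp only [mul_assoc _ (cs.simple i) (cs.simple j), mul_assoc _ (cs.simple j) (cs.simple i), hc]

theorem Good.commEquiv_of_isReduced (hM : ∀ i j, i ≠ j → M i j = 2 ∨ M i j = 3)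
    (hinj : Function.Injective cs.simple) {ω ω' : List B} (h : Good M.Adj ω) (hω : cs.IsReduced ω)
    (hω' : cs.IsReduced ω') (e : cs.wordProd ω = cs.wordProd ω') : CommEquiv M.Adj ω ω' := by
  induction hl : ω.length generalizing ω ω' with
  | zero =>
    have : ω'.length = 0 := by rw [← hω'.eq, ← e, hω.eq, hl]
    rw [List.length_eq_zero_iff] at hl this
    subst hl this
    exact .refl _
  | succ n ih =>
    have hl' : ω'.length = n + 1 := by rw [← hω'.eq, ← e, hω.eq, hl]
    match ω, ω', hl, hl' with
    | i :: a, j :: b, hl, hl' =>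
    rw [List.length_cons, add_left_inj] at hl hl'
    have ha := cs.isReduced_of_cons hω
    have hb := cs.isReduced_of_cons hω'
    have hi := cs.isLeftDescent_of_isReduced_cons hω
    have hj := cs.isLeftDescent_of_isReduced_cons hω'
    rw [← e] at hj
    by_cases hij : i = j
    · subst hij
      refine (ih h.1 ha hb ?_ hl).cons i
      simpa [CoxeterSystem.wordProd_cons] using e
    · rcases hM i j hij with h2 | h3
      · obtain ⟨c, hc, ec⟩ := cs.exists_isReduced_cons_cons (hinj.ne hij) hi hj
        have h1 : CommEquiv M.Adj (i :: a) (i :: j :: c) := by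
          refine (ih h.1 ha (cs.isReduced_of_cons hc) ?_ hl).cons i
          rw [cs.wordProd_cons, cs.wordProd_cons] at ec
          exact (mul_left_cancel ec).symm
        have h2' : CommEquiv M.Adj (i :: j :: c) (j :: i :: c) :=
          CommEquiv.swap ((eq_two_iff_of_simplyLaced hM).2 h2) c
        have h3 := h1.trans h2'
        have ep := h3.wordProd_eq (cs := cs) hM
        have hred : cs.IsReduced (j :: i :: c) := by
          rw [CoxeterSystem.IsReduced, ← ep, hω.eq, h3.perm.length_eq]
        refine h3.trans (CommEquiv.cons j (ih (h3.good_iff.1 h).1 (cs.isReduced_of_cons hred) hb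
          ?_ ?_))
        · rw [e, cs.wordProd_cons, cs.wordProd_cons j] at ep
          exact (mul_left_cancel ep).symm
        · simpa [hl] using h3.perm.length_eq.symm
      · obtain ⟨c, hc, ec⟩ := cs.exists_isReduced_cons_cons_cons (hinj.ne hij) h3 hi hj
        have h1 : CommEquiv M.Adj (i :: a) (i :: j :: i :: c) := by
          refine (ih h.1 ha (cs.isReduced_of_cons hc) ?_ hl).cons i
          rw [cs.wordProd_cons, cs.wordProd_cons] at ec
          exact (mul_left_cancel ec).symm
        exact absurd (h1.good_iff.1 h) (not_good_cons_cons_self hij c)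

theorem Good.isReduced (hM : ∀ i j, i ≠ j → M i j = 2 ∨ M i j = 3)
    (hinj : Function.Injective cs.simple) {ω : List B} (h : Good M.Adj ω) : cs.IsReduced ω := by
  induction ω with
  | nil => simp [CoxeterSystem.IsReduced]
  | cons i a ih =>
    have ha := ih h.1
    by_cases hd : cs.IsLeftDescent (cs.wordProd a) i
    · obtain ⟨c, hc, e⟩ := cs.exists_isReduced (cs.simple i * cs.wordProd a)
      have ep : cs.wordProd (i :: c) = cs.wordProd a := by rw [cs.wordProd_cons, ← e]; simp
      have hred : cs.IsReduced (i :: c) := by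
        rw [CoxeterSystem.IsReduced, ep, ← cs.isLeftDescent_iff.1 hd, e, hc.eq]; rfl
      have := (h.1.commEquiv_of_isReduced hM hinj ha hred ep.symm).cons i
      exact absurd (this.good_iff.1 h) (not_good_cons_self i c)
    · rw [CoxeterSystem.IsReduced, cs.wordProd_cons, cs.not_isLeftDescent_iff.1 hd, ha.eq]
      rfl

theorem Good.isFullyCommutative (hM : ∀ i j, i ≠ j → M i j = 2 ∨ M i j = 3)
    (hinj : Function.Injective cs.simple) {ω : List B} (h : Good M.Adj ω) :
    IsFullyCommutative cs (cs.wordProd ω) := by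
  intro ω₁ ω₂ h₁ h₂ e₁ e₂
  have hr := h.isReduced hM hinj
  rw [← commEquiv_iff_of_simplyLaced hM]
  exact (h.commEquiv_of_isReduced hM hinj hr h₁ e₁.symm).symm.trans
    (h.commEquiv_of_isReduced hM hinj hr h₂ e₂.symm)

theorem exists_of_not_good {adj : B → B → Prop} [DecidableRel adj] {ω : List B}
    (h : ¬ Good adj ω) :
    ∃ x s y z, ω = x ++ s :: (y ++ s :: z) ∧ s ∉ y ∧ y.countP (fun x => adj s x) < 2 := by
  induction ω with
  | nil => exact absurd good_nil h
  | cons a l ih =>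
    by_cases hl : Good adj l
    · have : ¬ Spaced adj a 2 l := fun h' => h ⟨hl, h'⟩
      rw [spaced_iff] at this
      push Not at this
      obtain ⟨y, z, rfl, hy, hc⟩ := this
      exact ⟨[], a, y, z, rfl, hy, hc⟩
    · obtain ⟨x, s, y, z, rfl, hy, hc⟩ := ih hl
      exact ⟨a :: x, s, y, z, rfl, hy, hc⟩

theorem wordProd_cons_comm (hM : ∀ i j, i ≠ j → M i j = 2 ∨ M i j = 3) {s : B} {y : List B}
    (hs : s ∉ y) (hy : y.countP (fun x => M.Adj s x) = 0) :
    cs.simple s * cs.wordProd y = cs.wordProd y * cs.simple s := by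
  have h : CommEquiv M.Adj (s :: y) (y ++ [s]) := by
    refine CommEquiv.cons_append_singleton fun x hx => ?_
    rw [List.countP_eq_zero] at hy
    refine ⟨fun e => hs (e ▸ hx), by simpa using hy x hx, ?_⟩
    rw [CoxeterMatrix.Adj, M.symmetric]
    simpa using hy x hx
  simpa [cs.wordProd_cons, cs.wordProd_append] using h.wordProd_eq (cs := cs) hM

theorem IsFullyCommutative.good (hM : ∀ i j, i ≠ j → M i j = 2 ∨ M i j = 3) {ω : List B}
    (h : IsFullyCommutative cs (cs.wordProd ω)) (hω : cs.IsReduced ω) : Good M.Adj ω := by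
  by_contra hn
  obtain ⟨x, s, y, z, rfl, hs, hc⟩ := exists_of_not_good hn
  obtain hc | hc : y.countP (fun x => M.Adj s x) = 0 ∨ y.countP (fun x => M.Adj s x) = 1 := by
    omega
  · have e : cs.wordProd (x ++ s :: (y ++ s :: z)) = cs.wordProd (x ++ (y ++ z)) := by
      simp only [cs.wordProd_append, cs.wordProd_cons, ← mul_assoc (cs.simple s) (cs.wordProd y),
        wordProd_cons_comm hM hs hc]
      simp [mul_assoc]
    have := cs.length_wordProd_le (x ++ (y ++ z))
    rw [← e, hω.eq] at this
    simp at this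
  · obtain ⟨t, ht, hst⟩ : ∃ t ∈ y, M.Adj s t := by
      have := List.countP_pos_iff.1 (hc ▸ zero_lt_one)
      simpa using this
    obtain ⟨y₁, y₂, rfl⟩ := List.append_of_mem ht
    rw [List.countP_append, List.countP_cons, if_pos (by simpa using hst)] at hc
    simp only [List.mem_append, List.mem_cons, not_or] at hs
    have h₁ := wordProd_cons_comm (cs := cs) hM hs.1 (by omega)
    have h₂ := wordProd_cons_comm (cs := cs) hM hs.2.2 (by omega)
    have hst' := cs.simple_mul_simple_mul_simple_of_eq_three hst
    have e : cs.wordProd (x ++ s :: ((y₁ ++ t :: y₂) ++ s :: z)) =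
        cs.wordProd (x ++ (y₁ ++ t :: s :: t :: (y₂ ++ z))) := by
      simp only [cs.wordProd_append, cs.wordProd_cons]
      calc _ = cs.wordProd x * ((cs.simple s * cs.wordProd y₁) * cs.simple t *
              (cs.wordProd y₂ * cs.simple s) * cs.wordProd z) := by simp only [mul_assoc]
        _ = cs.wordProd x * (cs.wordProd y₁ * (cs.simple s * cs.simple t * cs.simple s) *
              cs.wordProd y₂ * cs.wordProd z) := by rw [h₁, ← h₂]; simp only [mul_assoc]
        _ = _ := by rw [hst']; simp only [mul_assoc]
    have hred : cs.IsReduced (x ++ (y₁ ++ t :: s :: t :: (y₂ ++ z))) := by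
      rw [CoxeterSystem.IsReduced, ← e, hω.eq]
      simp
      omega
    have hperm := ((commEquiv_iff_of_simplyLaced hM _ _).2 (h _ _ hω hred rfl e.symm)).perm
    have := hperm.count_eq s
    simp [Ne.symm hs.2.1] at this
    omega

end SimplyLaced

section MoreWords

variable {α : Type*} {adj : α → α → Prop} [DecidableEq α] [DecidableRel adj]

theorem spaced_append_of_notMem {s : α} {u : List α} (h : s ∉ u) (c : ℕ) (l : List α) :
    Spaced adj s c (u ++ l) ↔ Spaced adj s (c - u.countP (fun x => adj s x)) l := by
  induction u generalizing c with
  | nil => simp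
  | cons a u ih =>
    rw [List.mem_cons, not_or] at h
    rw [List.cons_append, spaced_cons, if_neg (Ne.symm h.1), ih h.2, List.countP_cons]
    by_cases h' : adj s a
    · simp [h', Nat.sub_sub, add_comm]
    · simp [h']

theorem spaced_one_append {s x : α} {u : List α} (h : s ∉ u) (hx : x ∈ u) (hs : adj s x)
    (l : List α) : Spaced adj s 1 (u ++ l) := by
  have : 1 ≤ u.countP (fun x => adj s x) := List.one_le_countP_iff.2 ⟨x, hx, by simpa⟩
  rw [spaced_append_of_notMem h, Nat.sub_eq_zero_of_le this]
  exact spaced_zero _ _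

theorem not_spaced_two {s v : α} {u l l' : List α} (e : l' = u ++ s :: l) (h : s ∉ u)
    (hu : u.count v ≤ 1) (hv : ∀ x ∈ u, adj s x → x = v) : ¬ Spaced adj s 2 l' := by
  rw [e, spaced_append_of_notMem h, spaced_cons_self]
  have h1 : u.countP (fun x => adj s x) ≤ u.count v := by
    rw [List.count]
    exact List.countP_mono_left fun x hx h => by simpa using hv x hx (by simpa using h)
  omega

end MoreWords

/-! ### Normal forms of type `D` -/

section TypeD

/-- Adjacency in the infinite Coxeter graph of type `D`. -/
def AdjD (i j : ℕ) : Prop :=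
  (i = 0 ∧ j = 2) ∨ (j = 0 ∧ i = 2) ∨ (1 ≤ i ∧ 1 ≤ j ∧ (i + 1 = j ∨ j + 1 = i))

instance : DecidableRel AdjD := fun i j => by unfold AdjD; infer_instance

/-- The ascending word `a, a + 1, …, K`. -/
def ascending (a K : ℕ) : List ℕ := List.range' a (K + 1 - a)

/-- The word `b, …, 2, 0, 1, 2, …, K`. -/
def turning (b K : ℕ) : List ℕ := (ascending 2 b).reverse ++ 0 :: ascending 1 K

theorem mem_ascending {a K x : ℕ} : x ∈ ascending a K ↔ a ≤ x ∧ x ≤ K := by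
  rw [ascending, List.mem_range'_1]; omega

theorem nodup_ascending (a K : ℕ) : (ascending a K).Nodup := List.nodup_range'

theorem ascending_eq_nil {a K : ℕ} (h : K < a) : ascending a K = [] := by
  rw [ascending, Nat.sub_eq_zero_of_le (by omega), List.range'_zero]

theorem ascending_eq_cons {a K : ℕ} (h : a ≤ K) : ascending a K = a :: ascending (a + 1) K := by
  rw [ascending, ascending, show K + 1 - a = (K + 1 - (a + 1)) + 1 by omega, List.range'_succ]

theorem ascending_append {a b K : ℕ} (h : a ≤ b) (hb : 1 ≤ b) (hK : b ≤ K + 1) :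
    ascending a K = ascending a (b - 1) ++ ascending b K := by
  rw [ascending, ascending, ascending, show K + 1 - a = (b - 1 + 1 - a) + (K + 1 - b) by omega,
    ← List.range'_append_1, show a + (b - 1 + 1 - a) = b by omega]

theorem ascending_eq_append_cons {a t K : ℕ} (ha : a ≤ t) (h1 : 1 ≤ t) (ht : t ≤ K) :
    ascending a K = ascending a (t - 1) ++ t :: ascending (t + 1) K := by
  rw [ascending_append ha h1 (by omega), ascending_eq_cons ht]

theorem count_ascending_le_one (a K v : ℕ) : (ascending a K).count v ≤ 1 :=
  List.nodup_iff_count_le_one.1 (nodup_ascending a K) v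

theorem ascending_succ {a K : ℕ} (h : a ≤ K + 1) :
    ascending a (K + 1) = ascending a K ++ [K + 1] := by
  rw [ascending, ascending, show K + 1 + 1 - a = (K + 1 - a) + 1 by omega, List.range'_1_concat,
    show a + (K + 1 - a) = K + 1 by omega]

theorem turning_one (K : ℕ) : turning 1 K = 0 :: ascending 1 K := by
  simp [turning, ascending_eq_nil]

theorem turning_succ {b K : ℕ} (h : 1 ≤ b) : turning (b + 1) K = (b + 1) :: turning b K := by
  rw [turning, ascending_succ (by omega)]; simp [turning]

open scoped Classical in
/-- The final blocks of the normal forms which involve the letter `K` as largest letter. -/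
def blocks (K : ℕ) : Finset (List ℕ) :=
  insert (0 :: ascending 2 K) ((Finset.Icc 1 K).image (ascending · K) ∪
    (Finset.Icc 1 K).image (turning · K))

open scoped Classical in
/-- Normal forms, up to commutations, for the good words with letters `0, …, k`. -/
def normalForms : ℕ → Finset (List ℕ)
  | 0 => {[]}
  | k + 1 => normalForms k ∪ (blocks (k + 1)).biUnion fun ρ =>
      ((normalForms k).filter fun ν => Good AdjD (ρ ++ ν)).image (ρ ++ ·)

theorem mem_blocks {K : ℕ} {ρ : List ℕ} : ρ ∈ blocks K ↔ ρ = 0 :: ascending 2 K ∨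
    (∃ a, (1 ≤ a ∧ a ≤ K) ∧ ascending a K = ρ) ∨ ∃ b, (1 ≤ b ∧ b ≤ K) ∧ turning b K = ρ := by
  simp [blocks]

theorem mem_normalForms_succ {k : ℕ} {w : List ℕ} : w ∈ normalForms (k + 1) ↔
    w ∈ normalForms k ∨
      ∃ ρ ∈ blocks (k + 1), ∃ ν, (ν ∈ normalForms k ∧ Good AdjD (ρ ++ ν)) ∧ ρ ++ ν = w := by
  simp [normalForms]

theorem mem_turning {b K x : ℕ} (hb : 1 ≤ b) (hK : b ≤ K) (h : x ∈ turning b K) : x ≤ K := by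
  simp [turning, mem_ascending] at h
  omega

theorem le_of_mem_blocks {K x : ℕ} {ρ : List ℕ} (hρ : ρ ∈ blocks K) (hx : x ∈ ρ) : x ≤ K := by
  rw [mem_blocks] at hρ
  obtain rfl | ⟨a, h, rfl⟩ | ⟨b, h, rfl⟩ := hρ
  · simp [mem_ascending] at hx; omega
  · simp [mem_ascending] at hx; omega
  · exact mem_turning h.1 h.2 hx

theorem le_of_mem_normalForms {k : ℕ} {w : List ℕ} (hw : w ∈ normalForms k) :
    ∀ x ∈ w, x ≤ k ∧ 1 ≤ k := by
  induction k generalizing w with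
  | zero => simp [normalForms] at hw; simp [hw]
  | succ k ih =>
    obtain hw | ⟨ρ, hρ, ν, ⟨hν, -⟩, rfl⟩ := mem_normalForms_succ.1 hw
    · intro x hx; have := ih hw x hx; omega
    · intro x hx
      rw [List.mem_append] at hx
      obtain hx | hx := hx
      · have := le_of_mem_blocks hρ hx; omega
      · have := ih hν x hx; omega

theorem good_of_mem_normalForms {k : ℕ} {w : List ℕ} (hw : w ∈ normalForms k) : Good AdjD w := by
  induction k generalizing w with
  | zero => simp [normalForms] at hw; simp [hw]
  | succ k ih =>
    obtain hw | ⟨ρ, hρ, ν, ⟨-, h⟩, rfl⟩ := mem_normalForms_succ.1 hw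
    · exact ih hw
    · exact h

/-! #### Every good word is equivalent to a normal form -/

theorem not_spaced_two_turning {K t b : ℕ} (ht : t ≤ K) (hb : 1 ≤ b) (h : t ≠ b + 1)
    (ν : List ℕ) : ¬ Spaced AdjD t 2 (turning b K ++ ν) := by
  obtain rfl | rfl | ht' | ht' : t = 0 ∨ t = 1 ∨ (2 ≤ t ∧ t ≤ b) ∨ b + 2 ≤ t := by omega
  · refine not_spaced_two (v := 2) (u := (ascending 2 b).reverse) (l := ascending 1 K ++ ν)
      (by simp [turning]) ?_ ?_ ?_
    · simp [mem_ascending]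
    · simp [count_ascending_le_one]
    · simp [mem_ascending, AdjD]
  · refine not_spaced_two (v := 2) (u := (ascending 2 b).reverse ++ [0])
      (l := ascending 2 K ++ ν) (by simp [turning, ascending_eq_cons ht]) ?_ ?_ ?_
    · simp [mem_ascending]
    · simp [count_ascending_le_one]
    · simp [mem_ascending, AdjD]; grind
  · refine not_spaced_two (v := t + 1) (u := (ascending (t + 1) b).reverse)
      (l := (ascending 2 (t - 1)).reverse ++ 0 :: (ascending 1 K ++ ν)) ?_ ?_ ?_ ?_
    · simp [turning, ascending_eq_append_cons ht'.1 (by omega) ht'.2]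
    · simp [mem_ascending]
    · simp [count_ascending_le_one]
    · simp [mem_ascending, AdjD]; grind
  · refine not_spaced_two (v := t - 1) (u := turning b (t - 1)) (l := ascending (t + 1) K ++ ν)
      ?_ ?_ ?_ ?_
    · simp [turning, ascending_eq_append_cons (a := 1) (by omega) (by omega) ht]
    · simp [turning, mem_ascending]; omega
    · have h0 : t - 1 ∉ (ascending 2 b).reverse := by simp [mem_ascending]; omega
      rw [turning, List.count_append, List.count_eq_zero.2 h0,
        List.count_cons_of_ne (by omega), zero_add]
      exact count_ascending_le_one _ _ _
    · simp [turning, mem_ascending, AdjD]; grind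

theorem cons_block {K t : ℕ} (ht : t ≤ K) {ρ : List ℕ} (hρ : ρ ∈ blocks K) {ν : List ℕ}
    (h : Spaced AdjD t 2 (ρ ++ ν)) :
    (∃ ρ' ∈ blocks K, CommEquiv AdjD (t :: ρ) ρ') ∨
      t + 1 < K ∧ CommEquiv AdjD (t :: ρ) (ρ ++ [t]) := by
  rw [mem_blocks] at hρ
  obtain rfl | ⟨a, ha, rfl⟩ | ⟨b, hb, rfl⟩ := hρ
  · obtain rfl | rfl | ht' : t = 0 ∨ t = 1 ∨ 2 ≤ t := by omega
    · simp [spaced_cons_self] at h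
    · refine .inl ⟨turning 1 K, mem_blocks.2 (.inr (.inr ⟨1, by omega, rfl⟩)), ?_⟩
      rw [turning_one, ascending_eq_cons ht]
      exact .swap (by simp [AdjD]) _
    · refine absurd h (not_spaced_two (v := if t = 2 then 0 else t - 1)
        (u := 0 :: ascending 2 (t - 1)) (l := ascending (t + 1) K ++ ν) ?_ ?_ ?_ ?_)
      · simp [ascending_eq_append_cons ht' (by omega) ht]
      · simp [mem_ascending]; omega
      · refine List.nodup_iff_count_le_one.1 ?_ _
        simp [mem_ascending, nodup_ascending]
      · simp [mem_ascending, AdjD]; grind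
  · obtain h' | h' | ⟨rfl, rfl⟩ | ⟨rfl, rfl⟩ | h' : a ≤ t ∨ (1 ≤ t ∧ t + 1 = a) ∨
      (t = 0 ∧ a = 1) ∨ (t = 0 ∧ a = 2) ∨ (t + 1 < a ∧ 3 ≤ a) := by omega
    · refine absurd h (not_spaced_two (v := t - 1) (u := ascending a (t - 1))
        (l := ascending (t + 1) K ++ ν) ?_ ?_ (count_ascending_le_one _ _ _) ?_)
      · simp [ascending_eq_append_cons h' (by omega) ht]
      · simp [mem_ascending]; omega
      · simp [mem_ascending, AdjD]; omega
    · refine .inl ⟨ascending t K, mem_blocks.2 (.inr (.inl ⟨t, by omega, rfl⟩)), ?_⟩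
      rw [ascending_eq_cons ht, h'.2]
      exact .refl _
    · refine .inl ⟨turning 1 K, mem_blocks.2 (.inr (.inr ⟨1, by omega, rfl⟩)), ?_⟩
      rw [turning_one]
      exact .refl _
    · exact .inl ⟨_, mem_blocks.2 (.inl rfl), .refl _⟩
    · refine .inr ⟨by omega, .cons_append_singleton ?_⟩
      simp [mem_ascending, AdjD]; omega
  · by_cases h' : t = b + 1
    · refine .inl ⟨turning t K, mem_blocks.2 (.inr (.inr ⟨t, by omega, rfl⟩)), ?_⟩
      rw [h', turning_succ hb.1]
      exact .refl _
    · exact absurd h (not_spaced_two_turning ht hb.1 h' ν)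

theorem cons_normalForm {k t : ℕ} (hk : 1 ≤ k) (ht : t ≤ k) {ν : List ℕ}
    (hν : ν ∈ normalForms k) (h : Good AdjD (t :: ν)) :
    ∃ ν' ∈ normalForms k, CommEquiv AdjD (t :: ν) ν' := by
  induction k generalizing t ν with
  | zero => omega
  | succ k ih =>
    obtain hν | ⟨ρ, hρ, ν, ⟨hν', hg⟩, rfl⟩ := mem_normalForms_succ.1 hν
    · by_cases hk' : 1 ≤ k ∧ t ≤ k
      · obtain ⟨ν', h1, h2⟩ := ih hk'.1 hk'.2 hν h
        exact ⟨ν', mem_normalForms_succ.2 (.inl h1), h2⟩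
      · refine ⟨[t] ++ ν, mem_normalForms_succ.2 (.inr ⟨[t], mem_blocks.2 ?_, ν, ⟨hν, h⟩, rfl⟩),
          .refl _⟩
        obtain ⟨rfl, rfl⟩ | rfl : k = 0 ∧ t = 0 ∨ t = k + 1 := by omega
        · exact .inl rfl
        · refine .inr (.inl ⟨k + 1, by omega, ?_⟩)
          rw [ascending_eq_cons le_rfl, ascending_eq_nil (by omega)]
    · obtain ⟨ρ', hρ', h'⟩ | ⟨ht', h'⟩ := cons_block ht hρ h.2
      · have h' := h'.append_right ν
        exact ⟨ρ' ++ ν, mem_normalForms_succ.2 (.inr ⟨ρ', hρ', ν, ⟨hν', h'.good_iff.1 h⟩, rfl⟩), h'⟩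
      · have h' := h'.append_right ν
        have hg' := h'.good_iff.1 h
        rw [List.append_assoc] at hg' h'
        obtain ⟨ν'', h1, h2⟩ := ih (by omega) (by omega) hν' hg'.of_append
        have h' := h'.trans (h2.append_left ρ)
        exact ⟨ρ ++ ν'', mem_normalForms_succ.2 (.inr ⟨ρ, hρ, ν'', ⟨h1, h'.good_iff.1 h⟩, rfl⟩), h'⟩

theorem nil_mem_normalForms (k : ℕ) : [] ∈ normalForms k := by
  induction k with
  | zero => simp [normalForms]
  | succ k ih => exact mem_normalForms_succ.2 (.inl ih)

theorem exists_normalForm {k : ℕ} (hk : 1 ≤ k) {w : List ℕ} (hw : ∀ x ∈ w, x ≤ k)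
    (h : Good AdjD w) : ∃ ν ∈ normalForms k, CommEquiv AdjD w ν := by
  induction w with
  | nil => exact ⟨[], nil_mem_normalForms k, .refl _⟩
  | cons t w ih =>
    obtain ⟨ν, hν, h'⟩ := ih (fun x hx => hw x (by simp [hx])) h.1
    obtain ⟨ν', hν', h''⟩ := cons_normalForm hk (hw t (by simp)) hν ((h'.cons t).good_iff.1 h)
    exact ⟨ν', hν', (h'.cons t).trans h''⟩

end TypeD

section TypeD

/-! #### Goodness of a normal form -/

theorem spaced_ascending_succ {k s : ℕ} (hs : 1 ≤ s) (hk : s ≤ k) (c : ℕ) (ν : List ℕ) :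
    Spaced AdjD s c (ascending (s + 1) (k + 1) ++ ν) ↔ Spaced AdjD s (c - 1) ν := by
  rw [ascending_eq_cons (by omega), List.cons_append,
    spaced_cons_of_adj _ _ (by omega) (by simp [AdjD]; omega),
    spaced_append_of_forall_not_adj]
  simp [mem_ascending, AdjD]; omega

theorem spaced_zero_ascending_two {k : ℕ} (hk : 1 ≤ k) (c : ℕ) (ν : List ℕ) :
    Spaced AdjD 0 c (ascending 2 (k + 1) ++ ν) ↔ Spaced AdjD 0 (c - 1) ν := by
  rw [ascending_eq_cons (by omega), List.cons_append,
    spaced_cons_of_adj _ _ (by omega) (by simp [AdjD]),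
    spaced_append_of_forall_not_adj]
  simp [mem_ascending, AdjD]; omega

variable {k : ℕ} {ν : List ℕ}

theorem spaced_of_lt (hν : ∀ x ∈ ν, x ≤ k ∧ 1 ≤ k) {j : ℕ} (hj : k < j) (c : ℕ) :
    Spaced AdjD j c ν :=
  spaced_of_notMem (fun h => by have := hν j h; omega) c

theorem good_ascending_append (hν : ∀ x ∈ ν, x ≤ k ∧ 1 ≤ k) (hg : Good AdjD ν) {a : ℕ}
    (h1 : 1 ≤ a) (ha : a ≤ k + 2) :
    Good AdjD (ascending a (k + 1) ++ ν) ↔ ∀ j, a ≤ j → Spaced AdjD j 1 ν := by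
  induction ha using Nat.decreasingInduction with
  | self =>
    rw [ascending_eq_nil (by omega), List.nil_append]
    exact iff_of_true hg fun j hj => spaced_of_lt hν (by omega) 1
  | of_succ a ha ih =>
    rw [ascending_eq_cons (by omega), List.cons_append, good_cons, ih (by omega)]
    have : Spaced AdjD a 2 (ascending (a + 1) (k + 1) ++ ν) ↔ Spaced AdjD a 1 ν := by
      obtain h | rfl : a ≤ k ∨ a = k + 1 := by omega
      · exact spaced_ascending_succ h1 h 2 ν
      · rw [ascending_eq_nil (by omega)]
        exact iff_of_true (spaced_of_lt hν (by omega) _) (spaced_of_lt hν (by omega) _)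
    rw [this]
    constructor
    · rintro ⟨h, h'⟩ j hj
      obtain rfl | hj := hj.eq_or_lt
      · exact h'
      · exact h j hj
    · exact fun h => ⟨fun j hj => h j (by omega), h a le_rfl⟩

theorem good_zero_cons_append (hν : ∀ x ∈ ν, x ≤ k ∧ 1 ≤ k) (hg : Good AdjD ν) :
    Good AdjD (0 :: ascending 2 (k + 1) ++ ν) ↔
      Spaced AdjD 0 1 ν ∧ ∀ j, 2 ≤ j → Spaced AdjD j 1 ν := by
  rw [List.cons_append, good_cons, good_ascending_append hν hg (by omega) (by omega), and_comm]
  refine and_congr_left' ?_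
  rcases Nat.eq_zero_or_pos k with rfl | hk
  · obtain rfl : ν = [] := List.eq_nil_iff_forall_not_mem.2 fun x hx => by simpa using hν x hx
    simp [ascending_eq_nil, spaced_nil]
  · exact spaced_zero_ascending_two hk 2 ν

theorem good_turning {b K : ℕ} (h1 : 1 ≤ b) (hb : b ≤ K) : Good AdjD (turning b K) := by
  induction b, h1 using Nat.le_induction with
  | base =>
    obtain ⟨k, rfl⟩ : ∃ k, K = k + 1 := ⟨K - 1, by omega⟩
    rw [turning_one, good_cons]
    constructor
    · have := (good_ascending_append (k := k) (ν := []) (by simp) good_nil le_rfl (by omega)).2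
      simpa using this
    · exact spaced_of_notMem (by simp [mem_ascending]) _
  | succ b h1 ih =>
    rw [turning_succ h1, good_cons]
    refine ⟨ih (by omega), ?_⟩
    have e : turning b K = turning b b ++ (b + 1) :: ascending (b + 2) K := by
      simp [turning, ascending_eq_append_cons (a := 1) (t := b + 1) (K := K) (by omega) (by omega)
        hb]
    rw [e, spaced_append_of_notMem (fun h => by have := mem_turning h1 le_rfl h; omega),
      spaced_cons_self, turning, List.countP_append, List.countP_cons]
    have h1' : 1 ≤ (ascending 1 b).countP fun x => AdjD (b + 1) x :=
      List.one_le_countP_iff.2 ⟨b, mem_ascending.2 ⟨h1, le_rfl⟩, by simp [AdjD]; omega⟩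
    obtain rfl | h2 := h1.eq_or_lt
    · have : AdjD 2 0 := by simp [AdjD]
      simp only [this, decide_true, if_true]
      omega
    · have h2' : 1 ≤ (ascending 2 b).reverse.countP fun x => AdjD (b + 1) x :=
        List.one_le_countP_iff.2 ⟨b, by simp [mem_ascending]; omega, by simp [AdjD]; omega⟩
      omega

theorem good_turning_append (hν : ∀ x ∈ ν, x ≤ k ∧ 1 ≤ k) (hg : Good AdjD ν) {b : ℕ}
    (h1 : 1 ≤ b) (hb : b ≤ k + 1) : Good AdjD (turning b (k + 1) ++ ν) ↔ ν = [] := by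
  refine ⟨fun h => ?_, fun h => by rw [h, List.append_nil]; exact good_turning h1 hb⟩
  rw [turning, List.append_assoc, List.cons_append] at h
  obtain ⟨h2, h0⟩ := h.of_append
  rw [good_ascending_append hν hg le_rfl (by omega)] at h2
  cases ν with
  | nil => rfl
  | cons x ν =>
    exfalso
    rcases Nat.eq_zero_or_pos x with rfl | hx
    · have hk := (hν 0 (by simp)).2
      rw [ascending_eq_cons (by omega), List.cons_append,
        spaced_cons_of_not_adj _ _ (by omega) (by simp [AdjD]),
        spaced_zero_ascending_two hk, spaced_cons_self] at h0
      omega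
    · simpa [spaced_cons_self] using h2 x hx

/-! #### Profiles of normal forms -/

theorem spaced_one_ascending_append (hν : ∀ x ∈ ν, x ≤ k ∧ 1 ≤ k) {a j : ℕ} (h1 : 1 ≤ a)
    (hj : a < j) : Spaced AdjD j 1 (ascending a (k + 1) ++ ν) := by
  by_cases h : j ≤ k + 1
  · rw [ascending_append (b := j) (by omega) (by omega) (by omega), List.append_assoc]
    refine spaced_one_append (x := j - 1) ?_ ?_ ?_ _
    · simp [mem_ascending]; omega
    · simp [mem_ascending]; omega
    · simp [AdjD]; omega
  · refine spaced_of_notMem ?_ 1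
    rw [List.mem_append, mem_ascending]
    rintro (h | h)
    · omega
    · have := hν _ h; omega

theorem not_spaced_one_ascending_append {a K : ℕ} (h : a ≤ K) :
    ¬ Spaced AdjD a 1 (ascending a K ++ ν) := by
  rw [ascending_eq_cons h, List.cons_append, spaced_cons_self]; omega

theorem spaced_zero_one_ascending_one_append (hν : ∀ x ∈ ν, x ≤ k ∧ 1 ≤ k) :
    Spaced AdjD 0 1 (ascending 1 (k + 1) ++ ν) := by
  rw [ascending_eq_cons (by omega), List.cons_append,
        spaced_cons_of_not_adj _ _ (by omega) (by simp [AdjD])]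
  by_cases h : 1 ≤ k
  · rw [spaced_zero_ascending_two h]
    exact spaced_zero _ _
  · obtain rfl : ν = [] := List.eq_nil_iff_forall_not_mem.2 fun x hx => h (hν x hx).2
    rw [ascending_eq_nil (by omega)]
    trivial

theorem spaced_one_zero_cons_append (hν : ∀ x ∈ ν, x ≤ k ∧ 1 ≤ k) {j : ℕ} (hj : 1 ≤ j) :
    Spaced AdjD j 1 (0 :: ascending 2 (k + 1) ++ ν) := by
  obtain rfl | rfl | h : j = 1 ∨ j = 2 ∨ 2 < j := by omega
  · rw [List.cons_append, spaced_cons_of_not_adj _ _ (by omega) (by simp [AdjD])]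
    by_cases h : 1 ≤ k
    · rw [spaced_ascending_succ le_rfl h]
      exact spaced_zero _ _
    · obtain rfl : ν = [] := List.eq_nil_iff_forall_not_mem.2 fun x hx => h (hν x hx).2
      rw [ascending_eq_nil (by omega)]
      trivial
  · exact spaced_one_append (u := [0]) (x := 0) (by simp) (by simp) (by simp [AdjD]) _
  · rw [List.cons_append,
      spaced_cons_of_not_adj _ _ (by omega) (by simp [AdjD]; omega)]
    exact spaced_one_ascending_append hν (by omega) h

theorem not_spaced_one_turning {b K : ℕ} (h1 : 1 ≤ b) (hb : b ≤ K) :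
    ¬ Spaced AdjD b 1 (turning b K) := by
  obtain rfl | h := h1.eq_or_lt
  · rw [turning_one, spaced_cons_of_not_adj _ _ (by omega) (by simp [AdjD]),
      ascending_eq_cons hb, spaced_cons_self]
    omega
  · rw [show b = (b - 1) + 1 by omega, turning_succ (by omega), spaced_cons_self]
    omega

theorem not_spaced_zero_one_turning_one (K : ℕ) : ¬ Spaced AdjD 0 1 (turning 1 K) := by
  rw [turning_one, spaced_cons_self]; omega

theorem spaced_one_turning {b j K : ℕ} (h1 : 1 ≤ b) (hb : b ≤ K) (hj : b < j) :
    Spaced AdjD j 1 (turning b K) := by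
  by_cases h : j ≤ K
  · have e : turning b K = turning b (j - 1) ++ ascending j K := by
      simp [turning, ascending_append (a := 1) (b := j) (K := K) (by omega) (by omega) (by omega)]
    rw [e]
    refine spaced_one_append (x := if j = 2 then 0 else j - 1)
      (fun h => by have := mem_turning h1 (by omega) h; omega) ?_ ?_ _
    · simp [turning, mem_ascending]; grind
    · simp [AdjD]; grind
  · exact spaced_of_notMem (fun h => by have := mem_turning h1 hb h; omega) 1

end TypeD

section Signed

/-- The action of the generators on `ℤ` by signed permutations, as a function. -/
def signedSwapFun (k : ℕ) (x : ℤ) : ℤ :=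
  if k = 0 then
    if x = 1 then -2 else if x = -2 then 1 else if x = 2 then -1 else if x = -1 then 2 else x
  else if x = k then k + 1 else if x = k + 1 then k else if x = -k then -(k + 1) else
    if x = -(k + 1) then -k else x

theorem signedSwapFun_involutive (k : ℕ) : Function.Involutive (signedSwapFun k) := by
  intro x
  unfold signedSwapFun
  grind

/-- The action of the generators on `ℤ` by signed permutations. -/
def signedSwap (k : ℕ) : Equiv.Perm ℤ := (signedSwapFun_involutive k).toPerm

theorem signedSwap_apply (k : ℕ) (x : ℤ) : signedSwap k x = signedSwapFun k x := rfl

theorem signedSwap_mul_self (k : ℕ) : signedSwap k * signedSwap k = 1 := by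
  ext x
  exact signedSwapFun_involutive k x

theorem signedSwapFun_zero (x : ℤ) : signedSwapFun 0 x =
    if x = 1 then -2 else if x = -2 then 1 else if x = 2 then -1 else if x = -1 then 2 else x :=
  rfl

theorem signedSwapFun_of_pos {k : ℕ} (hk : 1 ≤ k) (x : ℤ) : signedSwapFun k x =
    if x = k then (k + 1 : ℤ) else if x = k + 1 then (k : ℤ) else if x = -k then -(k + 1 : ℤ) else
      if x = -(k + 1) then (-k : ℤ) else x :=
  if_neg (by omega)

theorem signedSwap_comm {i j : ℕ} (h : i ≠ j) (h' : ¬ AdjD i j) :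
    signedSwap i * signedSwap j = signedSwap j * signedSwap i := by
  wlog hij : i < j generalizing i j
  · exact (this h.symm (fun h => h' (by unfold AdjD at *; tauto)) (by omega)).symm
  ext x
  simp only [Equiv.Perm.mul_apply, signedSwap_apply]
  simp only [AdjD] at h'
  generalize hy : signedSwapFun j x = y
  generalize hy' : signedSwapFun i x = y'
  rw [signedSwapFun_of_pos (k := j) (by omega)] at hy ⊢
  obtain rfl | hi := Nat.eq_zero_or_pos i
  · rw [signedSwapFun_zero] at hy' ⊢
    push_cast at *
    grind (splits := 40)
  · rw [signedSwapFun_of_pos hi] at hy' ⊢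
    grind (splits := 40)

theorem signedSwap_braid {i j : ℕ} (h : AdjD i j) :
    signedSwap i * signedSwap j * signedSwap i = signedSwap j * signedSwap i * signedSwap j := by
  wlog hij : i < j generalizing i j
  · exact (this (by unfold AdjD at *; tauto) (by unfold AdjD at *; omega)).symm
  ext x
  simp only [Equiv.Perm.mul_apply, signedSwap_apply]
  generalize hy : signedSwapFun i x = y
  generalize hy' : signedSwapFun j x = y'
  generalize hz : signedSwapFun j y = z
  generalize hz' : signedSwapFun i y' = z'
  obtain ⟨rfl, rfl⟩ | ⟨hi, rfl⟩ : (i = 0 ∧ j = 2) ∨ (1 ≤ i ∧ j = i + 1) := by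
    simp only [AdjD] at h; omega
  · rw [signedSwapFun_zero] at hy hz' ⊢
    rw [signedSwapFun_of_pos (by omega)] at hy' hz ⊢
    push_cast at *
    grind (splits := 40)
  · rw [signedSwapFun_of_pos (by omega)] at hy hz' hy' hz ⊢
    rw [signedSwapFun_of_pos (by omega)]
    push_cast at *
    grind (splits := 40)

theorem signedSwap_injective : Function.Injective signedSwap := by
  intro i j h
  have h0 := DFunLike.congr_fun h (i + 1 : ℤ)
  have h1 := DFunLike.congr_fun h (j + 1 : ℤ)
  simp only [signedSwap_apply, signedSwapFun] at h0 h1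
  grind

end Signed

section TypeD

/-! #### Normal forms act by distinct signed permutations -/

/-- The signed permutation attached to a word. -/
def signedAct (w : List ℕ) : Equiv.Perm ℤ := (w.map signedSwap).prod

theorem signedAct_cons (a : ℕ) (w : List ℕ) (x : ℤ) :
    signedAct (a :: w) x = signedSwapFun a (signedAct w x) := by
  simp [signedAct, signedSwap_apply]

theorem signedAct_append (u w : List ℕ) : signedAct (u ++ w) = signedAct u * signedAct w := by
  simp [signedAct]

theorem signedAct_apply_of_lt {k : ℕ} {w : List ℕ} (hw : ∀ x ∈ w, x ≤ k ∧ 1 ≤ k) {y : ℤ}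
    (hy : k + 1 < y) : signedAct w y = y := by
  induction w with
  | nil => simp [signedAct]
  | cons a w ih =>
    have := hw a (by simp)
    rw [signedAct_cons, ih fun x hx => hw x (by simp [hx]), signedSwapFun]
    split_ifs <;> omega

theorem signedAct_ascending {a K : ℕ} (h1 : 1 ≤ a) (ha : a ≤ K + 1) :
    signedAct (ascending a K) (K + 1) = a := by
  induction ha using Nat.decreasingInduction with
  | self => simp [ascending_eq_nil, signedAct]
  | of_succ a ha ih =>
    rw [ascending_eq_cons (by omega), signedAct_cons, ih (by omega), signedSwapFun_of_pos h1]
    split_ifs <;> push_cast at * <;> omega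

theorem signedAct_zero_cons {K : ℕ} (hK : 1 ≤ K) :
    signedAct (0 :: ascending 2 K) (K + 1) = -1 := by
  rw [signedAct_cons, signedAct_ascending (by omega) (by omega)]
  rfl

theorem signedAct_turning {b K : ℕ} (h1 : 1 ≤ b) (hK : 1 ≤ K) :
    signedAct (turning b K) (K + 1) = -(b + 1) := by
  induction b, h1 using Nat.le_induction with
  | base =>
    rw [turning_one, signedAct_cons, signedAct_ascending (by omega) (by omega)]
    rfl
  | succ b h1 ih =>
    rw [turning_succ h1, signedAct_cons, ih, signedSwapFun_of_pos (by omega)]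
    split_ifs <;> push_cast at * <;> omega

theorem eq_of_mem_blocks {K : ℕ} (hK : 1 ≤ K) {ρ ρ' : List ℕ} (hρ : ρ ∈ blocks K)
    (hρ' : ρ' ∈ blocks K) (h : signedAct ρ (K + 1) = signedAct ρ' (K + 1)) : ρ = ρ' := by
  rw [mem_blocks] at hρ hρ'
  obtain rfl | ⟨a, ha, rfl⟩ | ⟨b, hb, rfl⟩ := hρ <;>
    obtain rfl | ⟨a', ha', rfl⟩ | ⟨b', hb', rfl⟩ := hρ' <;>
    simp (disch := omega) only [signedAct_zero_cons, signedAct_ascending, signedAct_turning] at h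
  any_goals omega
  · rfl
  · obtain rfl : a = a' := by omega
    rfl
  · obtain rfl : b = b' := by omega
    rfl

theorem signedAct_ne_of_mem_blocks {K : ℕ} (hK : 1 ≤ K) {ρ : List ℕ} (hρ : ρ ∈ blocks K) :
    signedAct ρ (K + 1) ≠ K + 1 := by
  rw [mem_blocks] at hρ
  obtain rfl | ⟨a, ha, rfl⟩ | ⟨b, hb, rfl⟩ := hρ <;>
    simp (disch := omega) only [signedAct_zero_cons, signedAct_ascending, signedAct_turning] <;>
    omega

theorem signedAct_append_apply {k : ℕ} (ρ : List ℕ) {ν : List ℕ} (hν : ν ∈ normalForms k) :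
    signedAct (ρ ++ ν) ((k + 1 : ℕ) + 1) = signedAct ρ ((k + 1 : ℕ) + 1) := by
  rw [signedAct_append, Equiv.Perm.mul_apply,
    signedAct_apply_of_lt (le_of_mem_normalForms hν) (by push_cast; omega)]

theorem append_ne_of_mem_blocks {k : ℕ} {ρ ν w : List ℕ} (hρ : ρ ∈ blocks (k + 1))
    (hν : ν ∈ normalForms k) (hw : w ∈ normalForms k) : signedAct (ρ ++ ν) ≠ signedAct w := by
  intro h
  have h' := signedAct_append_apply ρ hν
  rw [h, signedAct_apply_of_lt (le_of_mem_normalForms hw) (by push_cast; omega)] at h'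
  exact signedAct_ne_of_mem_blocks (by omega) hρ h'.symm

theorem eq_of_signedAct_append_eq {k : ℕ} {ρ ρ' ν ν' : List ℕ} (hρ : ρ ∈ blocks (k + 1))
    (hρ' : ρ' ∈ blocks (k + 1)) (hν : ν ∈ normalForms k) (hν' : ν' ∈ normalForms k)
    (h : signedAct (ρ ++ ν) = signedAct (ρ' ++ ν')) : ρ = ρ' := by
  refine eq_of_mem_blocks (by omega) hρ hρ' ?_
  rw [← signedAct_append_apply ρ hν, h, signedAct_append_apply ρ' hν']

theorem signedAct_injOn (k : ℕ) : Set.InjOn signedAct (normalForms k) := by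
  induction k with
  | zero => simp [normalForms]
  | succ k ih =>
    intro w hw w' hw' h
    rw [Finset.mem_coe, mem_normalForms_succ] at hw hw'
    obtain hw | ⟨ρ, hρ, ν, ⟨hν, -⟩, rfl⟩ := hw <;>
      obtain hw' | ⟨ρ', hρ', ν', ⟨hν', -⟩, rfl⟩ := hw'
    · exact ih hw hw' h
    · exact absurd h.symm (append_ne_of_mem_blocks hρ' hν' hw)
    · exact absurd h (append_ne_of_mem_blocks hρ hν hw')
    · obtain rfl := eq_of_signedAct_append_eq hρ hρ' hν hν' h
      rw [signedAct_append, signedAct_append, mul_right_inj] at h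
      rw [ih hν hν' h]

/-! #### Counting normal forms -/

open scoped Classical in
theorem card_filter_normalForms_succ (k : ℕ) (P : List ℕ → Prop) [DecidablePred P] :
    ((normalForms (k + 1)).filter P).card = ((normalForms k).filter P).card +
      ∑ ρ ∈ blocks (k + 1),
        ((normalForms k).filter fun ν => Good AdjD (ρ ++ ν) ∧ P (ρ ++ ν)).card := by
  rw [normalForms, Finset.filter_union, Finset.card_union_of_disjoint, Finset.filter_biUnion,
    Finset.card_biUnion]
  · congr 1
    refine Finset.sum_congr rfl fun ρ _ => ?_
    rw [Finset.filter_image, Finset.card_image_of_injective _ (List.append_right_injective ρ),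
      Finset.filter_filter]
  · intro ρ hρ ρ' hρ' hne
    simp only [Function.onFun, Finset.disjoint_left, Finset.mem_filter, Finset.mem_image]
    rintro _ ⟨⟨ν, ⟨hν, -⟩, rfl⟩, -⟩ ⟨⟨ν', ⟨hν', -⟩, h⟩, -⟩
    exact hne (eq_of_signedAct_append_eq hρ hρ' hν hν' (by rw [h]))
  · simp only [Finset.disjoint_left, Finset.mem_filter, Finset.mem_image, Finset.mem_biUnion]
    rintro w ⟨hw, -⟩ ⟨⟨ρ, hρ, ν, ⟨hν, -⟩, rfl⟩, -⟩
    exact append_ne_of_mem_blocks hρ hν hw rfl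

theorem sum_blocks {K : ℕ} (hK : 1 ≤ K) (f : List ℕ → ℕ) : ∑ ρ ∈ blocks K, f ρ =
    f (0 :: ascending 2 K) + ∑ a ∈ Finset.Icc 1 K, f (ascending a K) +
      ∑ b ∈ Finset.Icc 1 K, f (turning b K) := by
  classical
  rw [blocks, Finset.sum_insert, Finset.sum_union, Finset.sum_image, Finset.sum_image, add_assoc]
  · intro b hb b' hb' h
    rw [Finset.coe_Icc, Set.mem_Icc] at hb hb'
    have h := congrArg (fun w => signedAct w (K + 1)) h
    simp only [signedAct_turning hb.1 hK, signedAct_turning hb'.1 hK] at h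
    omega
  · intro a ha a' ha' h
    rw [Finset.coe_Icc, Set.mem_Icc] at ha ha'
    have h := congrArg (fun w => signedAct w (K + 1)) h
    simp (disch := omega) only [signedAct_ascending] at h
    omega
  · simp only [Finset.disjoint_left, Finset.mem_image, Finset.mem_Icc]
    rintro _ ⟨a, ha, rfl⟩ ⟨b, hb, h⟩
    have h := congrArg (fun w => signedAct w (K + 1)) h
    simp (disch := omega) only [signedAct_ascending, signedAct_turning] at h
    omega
  · simp only [Finset.mem_union, Finset.mem_image, Finset.mem_Icc]
    rintro (⟨a, ha, h⟩ | ⟨a, ha, h⟩) <;>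
      have h := congrArg (fun w => signedAct w (K + 1)) h <;>
      simp (disch := omega) only [signedAct_zero_cons, signedAct_ascending, signedAct_turning] at h <;>
      omega

open scoped Classical in
/-- The number of normal forms to which every letter larger than `c` can be prepended after
one adjacent letter. -/
def countAbove (k c : ℕ) : ℕ :=
  ((normalForms k).filter fun ν => ∀ j, c < j → Spaced AdjD j 1 ν).card

open scoped Classical in
/-- The variant of `countAbove k 0` where the roles of `0` and `1` are exchanged. -/
def countFork (k : ℕ) : ℕ :=
  ((normalForms k).filter fun ν => Spaced AdjD 0 1 ν ∧ ∀ j, 2 ≤ j → Spaced AdjD j 1 ν).card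

theorem countAbove_of_le {k c : ℕ} (h : k ≤ c) : countAbove k c = (normalForms k).card := by
  classical
  rw [countAbove, Finset.filter_true_of_mem]
  intro ν hν j hj
  exact spaced_of_lt (le_of_mem_normalForms hν) (by omega) 1

theorem countAbove_zero_left (c : ℕ) : countAbove 0 c = 1 := by
  rw [countAbove_of_le (by omega)]; simp [normalForms]

theorem countFork_zero : countFork 0 = 1 := by
  classical
  rw [countFork, Finset.filter_true_of_mem]
  · simp [normalForms]
  · simp [normalForms]

open scoped Classical in
theorem countAbove_succ {k c : ℕ} (hc : c ≤ k + 1) : countAbove (k + 1) c =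
    countAbove k c + countFork k + ∑ a ∈ Finset.Icc 1 c, countAbove k (a - 1) + c := by
  rw [countAbove, card_filter_normalForms_succ, sum_blocks (by omega), ← countAbove, countFork,
    ← add_assoc, ← add_assoc]
  congr 1
  · congr 1
    · congr 2
      refine Finset.filter_congr fun ν hν => ?_
      have h1 := le_of_mem_normalForms hν
      rw [good_zero_cons_append h1 (good_of_mem_normalForms hν), and_iff_left]
      exact fun j hj => spaced_one_zero_cons_append h1 (by omega)
    · rw [← Finset.sum_subset (Finset.Icc_subset_Icc_right hc)]
      · refine Finset.sum_congr rfl fun a ha => ?_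
        rw [Finset.mem_Icc] at ha
        rw [countAbove]
        congr 1
        refine Finset.filter_congr fun ν hν => ?_
        have h1 := le_of_mem_normalForms hν
        rw [good_ascending_append h1 (good_of_mem_normalForms hν) ha.1 (by omega), and_iff_left]
        · exact forall_congr' fun j => imp_congr_left (by omega)
        · exact fun j hj => spaced_one_ascending_append h1 ha.1 (by omega)
      · intro a ha ha'
        rw [Finset.mem_Icc] at ha ha'
        rw [Finset.card_eq_zero, Finset.filter_eq_empty_iff]
        exact fun ν _ h => not_spaced_one_ascending_append ha.2 (h.2 a (by omega))
  · have key (b : ℕ) (hb : b ∈ Finset.Icc 1 (k + 1)) : ((normalForms k).filter fun ν =>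
        Good AdjD (turning b (k + 1) ++ ν) ∧
          ∀ j, c < j → Spaced AdjD j 1 (turning b (k + 1) ++ ν)).card = if b ≤ c then 1 else 0 := by
      rw [Finset.mem_Icc] at hb
      split_ifs with hbc
      · rw [Finset.card_eq_one]
        refine ⟨[], ?_⟩
        ext ν
        rw [Finset.mem_filter, Finset.mem_singleton]
        constructor
        · rintro ⟨hν, h, -⟩
          exact (good_turning_append (le_of_mem_normalForms hν) (good_of_mem_normalForms hν)
            hb.1 hb.2).1 h
        · rintro rfl
          rw [List.append_nil]
          exact ⟨nil_mem_normalForms k, good_turning hb.1 hb.2,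
            fun j hj => spaced_one_turning hb.1 hb.2 (by omega)⟩
      · rw [Finset.card_eq_zero, Finset.filter_eq_empty_iff]
        rintro ν hν ⟨h, h'⟩
        rw [good_turning_append (le_of_mem_normalForms hν) (good_of_mem_normalForms hν)
            hb.1 hb.2] at h
        have := h' b (by omega)
        rw [h, List.append_nil] at this
        exact not_spaced_one_turning hb.1 hb.2 this
    rw [Finset.sum_congr rfl key, Finset.sum_ite, Finset.sum_const_zero, add_zero,
      Finset.sum_const, smul_eq_mul, mul_one]
    have : (Finset.Icc 1 (k + 1)).filter (· ≤ c) = Finset.Icc 1 c := by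
      ext; simp; omega
    rw [this]; simp

open scoped Classical in
theorem countFork_succ (k : ℕ) : countFork (k + 1) = countFork k + countAbove k 0 := by
  rw [countFork, card_filter_normalForms_succ, sum_blocks (by omega), ← countFork, countAbove]
  congr 1
  rw [Finset.card_eq_zero.2, zero_add, Finset.sum_eq_single 1, Finset.sum_eq_zero, add_zero]
  · congr 1
    refine Finset.filter_congr fun ν hν => ?_
    have h1 := le_of_mem_normalForms hν
    rw [good_ascending_append h1 (good_of_mem_normalForms hν) le_rfl (by omega), and_iff_left]
    · exact forall_congr' fun j => imp_congr_left (by omega)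
    · exact ⟨spaced_zero_one_ascending_one_append h1,
        fun j hj => spaced_one_ascending_append h1 le_rfl (by omega)⟩
  · intro b hb
    rw [Finset.mem_Icc] at hb
    rw [Finset.card_eq_zero, Finset.filter_eq_empty_iff]
    rintro ν hν ⟨h, h0, h'⟩
    rw [good_turning_append (le_of_mem_normalForms hν) (good_of_mem_normalForms hν)
      hb.1 hb.2] at h
    subst h
    rw [List.append_nil] at h0
    obtain rfl | hb' := hb.1.eq_or_lt
    · exact not_spaced_zero_one_turning_one _ h0
    · have := h' b hb'
      rw [List.append_nil] at this
      exact not_spaced_one_turning hb.1 hb.2 this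
  · intro a ha ha'
    rw [Finset.mem_Icc] at ha
    rw [Finset.card_eq_zero, Finset.filter_eq_empty_iff]
    exact fun ν _ h => not_spaced_one_ascending_append ha.2 (h.2.2 a (by omega))
  · simp
  · rw [Finset.filter_eq_empty_iff]
    rintro ν - ⟨-, h, -⟩
    rw [List.cons_append, spaced_cons_self] at h
    omega

theorem countFork_and_countAbove_zero (k : ℕ) : countFork k = 2 ^ k ∧ countAbove k 0 = 2 ^ k := by
  induction k with
  | zero => exact ⟨countFork_zero, countAbove_zero_left 0⟩
  | succ k ih =>
    have h := countAbove_succ (k := k) (c := 0) (by omega)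
    rw [countFork_succ, h, ih.1, ih.2]
    simp [pow_succ]
    omega

theorem countAbove_succ_succ {k c : ℕ} (hc : c ≤ k) :
    countAbove (k + 1) (c + 1) = countAbove (k + 1) c + countAbove k (c + 1) + 1 := by
  rw [countAbove_succ (by omega), countAbove_succ (by omega), Finset.sum_Icc_succ_top (by omega),
    Nat.add_sub_cancel]
  omega

theorem countAbove_one (k : ℕ) : countAbove k 1 + 1 = 2 ^ (k + 1) + k := by
  induction k with
  | zero => rw [countAbove_zero_left]; rfl
  | succ k ih =>
    rw [countAbove_succ_succ (by omega), (countFork_and_countAbove_zero _).2, pow_succ _ (k + 1),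
      zero_add]
    omega

theorem sum_choose_succ (k d : ℕ) (h : d ≤ k) :
    ∑ j ∈ Finset.Icc (d + 1) (k + 1), (k + 1 + (d + 1)).choose j =
      ∑ j ∈ Finset.Icc d (k + 1), (k + 1 + d).choose j +
        ∑ j ∈ Finset.Icc (d + 1) k, (k + (d + 1)).choose j := by
  have h1 : ∑ j ∈ Finset.Icc (d + 1) (k + 1), (k + 1 + (d + 1)).choose j =
      ∑ j ∈ Finset.Icc d k, ((k + 1 + d).choose j + (k + 1 + d).choose (j + 1)) := by
    rw [← Finset.map_add_right_Icc, Finset.sum_map]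
    exact Finset.sum_congr rfl fun j _ => Nat.choose_succ_succ _ _
  have h2 : ∑ j ∈ Finset.Icc d k, (k + 1 + d).choose (j + 1) =
      ∑ j ∈ Finset.Icc (d + 1) (k + 1), (k + 1 + d).choose j := by
    rw [← Finset.map_add_right_Icc, Finset.sum_map]
    rfl
  rw [h1, Finset.sum_add_distrib, h2, Finset.sum_Icc_succ_top (b := k) (by omega),
    Finset.sum_Icc_succ_top (b := k) (by omega), show k + (d + 1) = k + 1 + d by omega]
  omega

theorem countAbove_add_choose (k d : ℕ) (hd : d ≤ k + 1) :
    (if d ≤ k then countAbove k (d + 1) + 1 else 0) + (k + d + 2).choose (k + 2) +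
        (k + d).choose k =
      2 * ∑ j ∈ Finset.Icc d k, (k + d).choose j + (k + d + 2).choose (k + 1) +
        (k + d).choose (k + 1) := by
  have diag (k : ℕ) :
      (if k + 1 ≤ k then countAbove k (k + 1 + 1) + 1 else 0) + (k + (k + 1) + 2).choose (k + 2) +
        (k + (k + 1)).choose k =
      2 * ∑ j ∈ Finset.Icc (k + 1) k, (k + (k + 1)).choose j +
        (k + (k + 1) + 2).choose (k + 1) + (k + (k + 1)).choose (k + 1) := by
    rw [if_neg (by omega), Finset.Icc_eq_empty (by omega), Finset.sum_empty,
      Nat.choose_symm_of_eq_add (show k + (k + 1) + 2 = (k + 2) + (k + 1) by omega),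
      Nat.choose_symm_of_eq_add (show k + (k + 1) = k + (k + 1) by omega)]
    omega
  induction k generalizing d with
  | zero =>
    obtain rfl | rfl : d = 0 ∨ d = 1 := by omega
    · rw [if_pos le_rfl, countAbove_zero_left]; decide
    · exact diag 0
  | succ k ih =>
    induction d with
    | zero =>
      rw [if_pos (by omega), zero_add, countAbove_one, add_zero, Nat.choose_self,
        Nat.choose_self, Nat.choose_succ_self, Nat.choose_succ_self_right, pow_succ,
        ← Nat.sum_range_choose (k + 1), Finset.range_eq_Ico]
      have : Finset.Ico 0 (k + 1 + 1) = Finset.Icc 0 (k + 1) := rfl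
      rw [this]
      omega
    | succ d ihd =>
      obtain rfl | hd' : d = k + 1 ∨ d ≤ k := by omega
      · exact diag (k + 1)
      have h1 : (if d + 1 ≤ k + 1 then countAbove (k + 1) (d + 1 + 1) + 1 else 0) =
          (if d ≤ k + 1 then countAbove (k + 1) (d + 1) + 1 else 0) +
            (if d + 1 ≤ k then countAbove k (d + 1 + 1) + 1 else 0) := by
        rw [if_pos (by omega), if_pos (by omega)]
        split_ifs with h
        · rw [countAbove_succ_succ h]; omega
        · rw [countAbove_of_le (by omega), countAbove_of_le (by omega)]
      have h2 := ihd (by omega)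
      have h3 := ih (d + 1) (by omega)
      rw [h1, sum_choose_succ k d hd']
      rw [show k + 1 + d + 2 = k + d + 3 by omega, show k + 1 + d = k + d + 1 by omega] at h2
      rw [show k + (d + 1) + 2 = k + d + 3 by omega, show k + (d + 1) = k + d + 1 by omega] at h3
      rw [show k + 1 + (d + 1) + 2 = k + d + 3 + 1 by omega,
        show k + 1 + (d + 1) = k + d + 1 + 1 by omega, show k + 1 + d = k + d + 1 by omega,
        show k + (d + 1) = k + d + 1 by omega, show k + 1 + 2 = k + 2 + 1 by omega,
        Nat.choose_succ_succ (k + d + 3), Nat.choose_succ_succ (k + d + 1) k,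
        Nat.choose_succ_succ (k + d + 3) (k + 1), Nat.choose_succ_succ (k + d + 1) (k + 1)]
      simp only [Nat.succ_eq_add_one, add_assoc, Nat.reduceAdd] at h2 h3 ⊢
      omega

theorem two_mul_card_normalForms_add_two (k : ℕ) :
    2 * (normalForms k).card + 2 = (k + 4) * catalan (k + 1) := by
  have h := countAbove_add_choose k k (by omega)
  rw [if_pos le_rfl, countAbove_of_le (by omega), Finset.Icc_self, Finset.sum_singleton] at h
  have h1 := succ_mul_catalan_eq_centralBinom (k + 1)
  rw [Nat.centralBinom, show 2 * (k + 1) = k + k + 2 by omega] at h1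
  have h2 := Nat.choose_succ_right_eq (k + k + 2) (k + 1)
  rw [show k + k + 2 - (k + 1) = k + 1 by omega, ← h1] at h2
  have h3 : (k + k + 2).choose (k + 1 + 1) = (k + 1) * catalan (k + 1) := by
    refine Nat.eq_of_mul_eq_mul_right (show 0 < k + 1 + 1 by omega) ?_
    rw [h2]; ring
  have h4 : (k + k + 2).choose (k + 1) = 2 * ((k + k).choose k + (k + k).choose (k + 1)) := by
    rw [← Nat.choose_succ_succ, Nat.choose_succ_succ,
      Nat.choose_symm_of_eq_add (show k + k + 1 = k + (k + 1) by omega)]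
    ring
  rw [show k + 2 = k + 1 + 1 by rfl, h3, ← h1] at h
  rw [← h1] at h4
  nlinarith

end TypeD

/-! ### Fully commutative elements of type `D` -/

theorem CommEquiv.exists_map_eq {α β : Type*} {adj : α → α → Prop} {adj' : β → β → Prop}
    {f : α → β} (hadj : ∀ i j, adj' (f i) (f j) ↔ adj i j) {ω : List α} {ν : List β}
    (h : CommEquiv adj' (ω.map f) ν) : ∃ ω', CommEquiv adj ω ω' ∧ ω'.map f = ν := by
  induction h with
  | refl => exact ⟨ω, .refl _, rfl⟩
  | tail _ h ih =>
    obtain ⟨ω', h', e⟩ := ih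
    obtain ⟨i, j, l₁, l₂, hij, e', rfl⟩ := h
    rw [e', List.append_assoc, List.map_eq_append_iff] at e
    obtain ⟨u, v, rfl, rfl, e⟩ := e
    rw [List.cons_append, List.cons_append, List.nil_append, List.map_eq_cons_iff] at e
    obtain ⟨a, v, rfl, rfl, e⟩ := e
    rw [List.map_eq_cons_iff] at e
    obtain ⟨b, v, rfl, rfl, rfl⟩ := e
    rw [hadj, hadj] at hij
    exact ⟨u ++ b :: a :: v, h'.trans
      ((CommEquiv.swap ⟨fun e => hij.1 (congrArg f e), hij.2⟩ v).append_left u), by simp⟩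

section TypeD

variable {n : ℕ}

theorem DnMatrix_apply (i j : Fin n) :
    DnMatrix n i j = if i = j then 1 else if DnAdj n i j then 3 else 2 := rfl

theorem DnMatrix_simplyLaced (i j : Fin n) (h : i ≠ j) :
    DnMatrix n i j = 2 ∨ DnMatrix n i j = 3 := by
  rw [DnMatrix_apply, if_neg h]
  split <;> simp

theorem adjD_val_iff (i j : Fin n) : AdjD i j ↔ (DnMatrix n).Adj i j := by
  have h : AdjD i j ↔ DnAdj n i j := Iff.rfl
  rw [CoxeterMatrix.Adj, DnMatrix_apply, h]
  by_cases e : i = j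
  · subst e
    simp only [if_true, DnAdj]
    omega
  · rw [if_neg e]
    split <;> simp_all

theorem isLiftable_signedSwap :
    (DnMatrix n).IsLiftable (fun i : Fin n => signedSwap i) := by
  intro i j
  have hi := signedSwap_mul_self (i : ℕ)
  have hj := signedSwap_mul_self (j : ℕ)
  dsimp only
  generalize hs : signedSwap (i : ℕ) = s at *
  generalize ht : signedSwap (j : ℕ) = t at *
  rw [DnMatrix_apply]
  split_ifs with h h'
  · subst h
    rw [← ht, hs, pow_one, hi]
  · have hb := signedSwap_braid (i := i) (j := j) h'
    rw [hs, ht] at hb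
    calc (s * t) ^ 3 = (s * t * s) * (t * s * t) := by
          simp only [pow_succ, pow_zero, one_mul, mul_assoc]
      _ = (s * t * s) * (s * t * s) := by rw [hb]
      _ = s * (t * (s * s) * t) * s := by simp only [mul_assoc]
      _ = 1 := by rw [hi, mul_one, hj, mul_one, hi]
  · have hc := signedSwap_comm (fun e => h (Fin.ext e)) h'
    rw [hs, ht] at hc
    calc (s * t) ^ 2 = (s * t) * (s * t) := pow_two _
      _ = (s * t) * (t * s) := by rw [hc]
      _ = s * (t * t) * s := by simp only [mul_assoc]
      _ = 1 := by rw [hj, mul_one, hi]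

/-- The homomorphism from `W(Dₙ)` to signed permutations. -/
def signedHom (n : ℕ) : (DnMatrix n).Group →* Equiv.Perm ℤ :=
  (DnMatrix n).toCoxeterSystem.lift ⟨_, isLiftable_signedSwap⟩

theorem signedHom_simple (i : Fin n) :
    signedHom n ((DnMatrix n).toCoxeterSystem.simple i) = signedSwap i :=
  (DnMatrix n).toCoxeterSystem.lift_apply_simple isLiftable_signedSwap i

theorem signedHom_wordProd (ω : List (Fin n)) :
    signedHom n ((DnMatrix n).toCoxeterSystem.wordProd ω) = signedAct (ω.map Fin.val) := by
  rw [CoxeterSystem.wordProd, map_list_prod, signedAct, List.map_map, List.map_map]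
  exact congrArg List.prod (List.map_congr_left fun i _ => signedHom_simple i)

theorem simple_injective_DnMatrix :
    Function.Injective (DnMatrix n).toCoxeterSystem.simple := fun i j h =>
  Fin.ext (signedSwap_injective (by rw [← signedHom_simple, ← signedHom_simple, h]))

theorem isFullyCommutative_iff_exists_normalForm {k : ℕ} (hk : 1 ≤ k)
    (w : (DnMatrix (k + 1)).Group) :
    IsFullyCommutative (DnMatrix (k + 1)).toCoxeterSystem w ↔
      ∃ ω : List (Fin (k + 1)), ω.map Fin.val ∈ normalForms k ∧
        (DnMatrix (k + 1)).toCoxeterSystem.wordProd ω = w := by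
  have hmap (ω : List (Fin (k + 1))) :=
    good_map_iff Fin.val_injective adjD_val_iff ω
  constructor
  · intro h
    obtain ⟨ω, hω, rfl⟩ := (DnMatrix (k + 1)).toCoxeterSystem.exists_isReduced w
    have hg := (hmap ω).2 (h.good DnMatrix_simplyLaced hω)
    obtain ⟨ν, hν, e⟩ := exists_normalForm hk (fun x hx => by
      obtain ⟨i, -, rfl⟩ := List.mem_map.1 hx
      exact Fin.is_le i) hg
    obtain ⟨ω', e', rfl⟩ := e.exists_map_eq adjD_val_iff
    exact ⟨ω', hν, (e'.wordProd_eq DnMatrix_simplyLaced).symm⟩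
  · rintro ⟨ω, hω, rfl⟩
    exact Good.isFullyCommutative DnMatrix_simplyLaced simple_injective_DnMatrix
      ((hmap ω).1 (good_of_mem_normalForms hω))

theorem injOn_signedHom {k : ℕ} (hk : 1 ≤ k) : Set.InjOn (signedHom (k + 1))
    {w | IsFullyCommutative (DnMatrix (k + 1)).toCoxeterSystem w} := by
  intro w hw w' hw' e
  obtain ⟨ω, hω, rfl⟩ := (isFullyCommutative_iff_exists_normalForm hk w).1 hw
  obtain ⟨ω', hω', rfl⟩ := (isFullyCommutative_iff_exists_normalForm hk w').1 hw'
  rw [signedHom_wordProd, signedHom_wordProd] at e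
  rw [Fin.val_injective.list_map (signedAct_injOn k hω hω' e)]

theorem image_signedHom {k : ℕ} (hk : 1 ≤ k) : signedHom (k + 1) ''
    {w | IsFullyCommutative (DnMatrix (k + 1)).toCoxeterSystem w} =
      signedAct '' (normalForms k : Set (List ℕ)) := by
  ext p
  constructor
  · rintro ⟨w, hw, rfl⟩
    obtain ⟨ω, hω, rfl⟩ := (isFullyCommutative_iff_exists_normalForm hk w).1 hw
    exact ⟨_, hω, (signedHom_wordProd ω).symm⟩
  · rintro ⟨ν, hν, rfl⟩
    obtain ⟨ω, rfl⟩ : ∃ ω : List (Fin (k + 1)), ω.map Fin.val = ν := by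
      lift ν to List (Fin (k + 1)) using fun x hx =>
        Nat.lt_succ_of_le (le_of_mem_normalForms hν x hx).1
      exact ⟨ν, rfl⟩
    exact ⟨_, (isFullyCommutative_iff_exists_normalForm hk _).2 ⟨ω, hν, rfl⟩, signedHom_wordProd ω⟩

end TypeD

/-- For `n ≥ 4`, the set of fully commutative elements of the Coxeter group `W(Dₙ)` is
finite, of cardinality `((n + 3)·C(n) − 2)/2 = ((n + 3)/2)·C(n) − 1`, where `C(n)` is the
`n`-th Catalan number. -/
theorem card_fullyCommutative_Dn (n : ℕ) (hn : 4 ≤ n) :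
    {w : (DnMatrix n).Group |
        IsFullyCommutative (DnMatrix n).toCoxeterSystem w}.Finite ∧
    Nat.card {w : (DnMatrix n).Group |
        IsFullyCommutative (DnMatrix n).toCoxeterSystem w} =
      ((n + 3) * catalan n - 2) / 2 := by
  obtain ⟨k, rfl⟩ : ∃ k, n = k + 1 := ⟨n - 1, by omega⟩
  have hk : 1 ≤ k := by omega
  refine ⟨Set.Finite.of_finite_image ?_ (injOn_signedHom hk), ?_⟩
  · rw [image_signedHom hk]
    exact (normalForms k).finite_toSet.image _
  · rw [Nat.card_coe_set_eq, ← (injOn_signedHom hk).ncard_image, image_signedHom hk,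
      (signedAct_injOn k).ncard_image, Set.ncard_coe_finset]
    have h := two_mul_card_normalForms_add_two k
    rw [show k + 1 + 3 = k + 4 by rfl]
    omega

end
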